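/- arXiv:1109.6559 — 3 statements merged into one kernel-verified Lean document; each statement's English description precedes it below -/
import Mathlib

section
/- Let H be a finite group such that every element of H is conjugate to its inverse via an element of Aut(H). If V is an irreducible kH-module over a field k, then the dual module V* is isomorphic to the twist V^x of V by some automorphism x of H. -/
/-- Density for a finite family of pairwise non-isomorphic simple modules. -/
theorem aux_density {K A ι : Type*} [Field K] [IsAlgClosed K] [Ring A] [Algebra K A]
    [Finite ι] [DecidableEq ι] (M : ι → Type*) [∀ i, AddCommGroup (M i)] [∀ i, Module K (M i)]
    [∀ i, Module A (M i)] [∀ i, IsScalarTower K A (M i)] [∀ i, IsSimpleModule A (M i)]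
    [∀ i, FiniteDimensional K (M i)]
    (hne : ∀ i j, i ≠ j → ∀ f : M i →ₗ[A] M j, f = 0)
    (i : ι) (T : M i →ₗ[K] M i) :
    ∃ a : A, (∀ m : M i, a • m = T m) ∧ ∀ j, j ≠ i → ∀ m : M j, a • m = 0 := by
  classical
  have := Fintype.ofFinite ι
  have hcomm : ∀ (g : Module.End A (∀ i, M i)) (m : ∀ i, M i),
      Pi.single i (T ((g m) i)) = g (Pi.single i (T (m i))) := by
    intro g m
    have key : ∀ (g : Module.End A (∀ i, M i)) (j : ι), j ≠ i → ∀ m : M j,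
        (g (Pi.single j m)) i = 0 := by
      intro g j hj m
      have := hne j i hj ((LinearMap.proj i) ∘ₗ g ∘ₗ (LinearMap.single A M j))
      simpa using congrArg (fun f => f m) this
    have key2 : ∀ (j : ι), j ≠ i → ∀ m : M i, (g (Pi.single i m)) j = 0 := by
      intro j hj m
      have := hne i j hj.symm ((LinearMap.proj j) ∘ₗ g ∘ₗ (LinearMap.single A M i))
      simpa using congrArg (fun f => f m) this
    obtain ⟨c, hc⟩ := (IsSimpleModule.algebraMap_end_bijective_of_isAlgClosed (A := A)
      (V := M i) K).2 ((LinearMap.proj i) ∘ₗ g ∘ₗ (LinearMap.single A M i))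
    have hc' : ∀ m : M i, (g (Pi.single i m)) i = c • m := by
      intro m
      have := congrArg (fun f => f m) hc
      simpa [Module.algebraMap_end_apply] using this.symm
    have hgm : (g m) i = c • m i := by
      conv_lhs => rw [← Finset.univ_sum_single m, map_sum, Finset.sum_apply]
      rw [Finset.sum_eq_single i]
      · exact hc' _
      · intro j _ hj
        exact key g j hj _
      · simp
    ext j
    by_cases hj : j = i
    · subst hj
      rw [hgm, hc']
      simp
    · rw [key2 j hj]
      simp [hj]
  let f : Module.End (Module.End A (∀ i, M i)) (∀ i, M i) :=
    { toFun := fun m => Pi.single i (T (m i))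
      map_add' := by
        intro x y
        simp [Pi.single_add]
      map_smul' := by
        intro g m
        exact hcomm g m }
  let b := fun j => Module.finBasis K (M j)
  let s : Finset (∀ i, M i) := Finset.univ.image
    (fun p : Σ j, Fin (Module.finrank K (M j)) => Pi.single p.1 (b p.1 p.2))
  obtain ⟨a, ha⟩ := jacobson_density (R := A) f s
  have ha' : ∀ j p, Pi.single i (T ((Pi.single j (b j p) : ∀ i, M i) i))
      = a • (Pi.single j (b j p) : ∀ i, M i) := fun j p =>
    ha (Pi.single j (b j p)) (Finset.mem_image.2 ⟨⟨j, p⟩, Finset.mem_univ _, rfl⟩)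
  refine ⟨a, ?_, ?_⟩
  · have : Algebra.lsmul K K (M i) a = T := by
      refine (b i).ext fun p => ?_
      have := congrFun (ha' i p) i
      simpa using this.symm
    intro m
    exact congrArg (fun f => f m) this
  · intro j hj
    have : Algebra.lsmul K K (M j) a = 0 := by
      refine (b j).ext fun p => ?_
      have := congrFun (ha' j p) j
      simpa [hj, hj.symm] using this.symm
    intro m
    exact congrArg (fun f => f m) this

/-- Linear independence of irreducible characters. -/
theorem aux_li {K H W ι : Type*} [Field K] [IsAlgClosed K] [Group H] [AddCommGroup W] [Module K W]
    [FiniteDimensional K W] [Nontrivial W] [Fintype ι]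
    (ρ : ι → Representation K H W) (hirr : ∀ i, (ρ i).IsIrreducible)
    (hne : ∀ i j, i ≠ j → ∀ e : W ≃ₗ[K] W, ¬ ∀ h w, e (ρ i h w) = ρ j h (e w))
    (c : ι → K) (hc : ∀ h, ∑ i, c i * LinearMap.trace K W (ρ i h) = 0) (i : ι) : c i = 0 := by
  classical
  have hc' : ∀ a : MonoidAlgebra K H,
      ∑ i, c i * LinearMap.trace K W ((ρ i).asAlgebraHom a) = 0 := by
    intro a
    induction a using MonoidAlgebra.induction_on with
    | of h => simpa using hc h
    | add x y hx hy => simp [mul_add, Finset.sum_add_distrib, hx, hy]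
    | smul r x hx =>
      have : ∀ i, c i * LinearMap.trace K W ((ρ i).asAlgebraHom (r • x))
          = r * (c i * LinearMap.trace K W ((ρ i).asAlgebraHom x)) := by
        intro i; simp; ring
      simp only [this, ← Finset.mul_sum, hx, mul_zero]
  obtain ⟨T, hT⟩ : ∃ T : W →ₗ[K] W, LinearMap.trace K W T = 1 := by
    obtain ⟨w, hw⟩ := exists_ne (0 : W)
    obtain ⟨ξ, hξ⟩ := Module.Projective.exists_dual_ne_zero K hw
    refine ⟨LinearMap.smulRight ((ξ w)⁻¹ • ξ) w, ?_⟩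
    rw [LinearMap.trace_smulRight]
    simp [hξ]
  obtain ⟨a, ha, ha0⟩ := aux_density (K := K) (A := MonoidAlgebra K H)
    (fun i => (ρ i).asModule) (by
      intro i j hij f
      by_contra hf
      have hb := (LinearMap.bijective_or_eq_zero f).resolve_right hf
      let e := (LinearEquiv.ofBijective f hb)
      refine hne i j hij ((ρ i).asModuleEquiv.symm ≪≫ₗ e.restrictScalars K ≪≫ₗ
        (ρ j).asModuleEquiv) ?_
      intro h w
      have := e.map_smul (MonoidAlgebra.single h (1 : K)) ((ρ i).asModuleEquiv.symm w)
      rw [Representation.single_smul, Representation.single_smul] at this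
      rw [one_smul, one_smul] at this
      exact this) i T
  have h1 : (ρ i).asAlgebraHom a = T := by
    ext w; exact ha w
  have h0 : ∀ j, j ≠ i → (ρ j).asAlgebraHom a = 0 := by
    intro j hj; ext w; exact ha0 j hj w
  have := hc' a
  rw [Finset.sum_eq_single i] at this
  · simpa [h1, hT] using this
  · intro j _ hj
    simp [h0 j hj]
  · simp

theorem aux_irr {K H W : Type*} [Field K] [Group H] [AddCommGroup W] [Module K W]
    [Nontrivial W] (ρ : Representation K H W)
    (hirr : ∀ U : Submodule K W, (∀ h w, w ∈ U → ρ h w ∈ U) → U = ⊥ ∨ U = ⊤) (x : MulAut H) :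
    Representation.IsIrreducible (ρ.comp (x : H →* H) : Representation K H W) := by
  have hb : ∀ U : Subrepresentation (ρ.comp (x : H →* H) : Representation K H W),
      U = ⊥ ∨ U = ⊤ := by
    intro U
    have := hirr U.toSubmodule (by
      intro h w hw
      have := U.apply_mem_toSubmodule (x.symm h) hw
      simpa using this)
    rcases this with h | h
    · left
      exact Subrepresentation.toSubmodule_injective h
    · right
      exact Subrepresentation.toSubmodule_injective h
  have hn : Nontrivial (Subrepresentation (ρ.comp (x : H →* H) : Representation K H W)) := by
    refine ⟨⊥, ⊤, fun h => ?_⟩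
    have := congrArg Subrepresentation.toSubmodule h
    exact bot_ne_top (α := Submodule K W) this
  exact { eq_bot_or_eq_top := hb }

/-- The theorem over an algebraically closed field. -/
theorem aux_closed {K H W : Type*} [Field K] [IsAlgClosed K] [Group H] [Finite H]
    [AddCommGroup W] [Module K W]
    [FiniteDimensional K W] [Nontrivial W]
    (hconj : ∀ h : H, ∃ φ : MulAut H, φ h = h⁻¹) (ρ : Representation K H W)
    (hirr : ∀ U : Submodule K W, (∀ h w, w ∈ U → ρ h w ∈ U) → U = ⊥ ∨ U = ⊤) :
    ∃ (x : MulAut H) (e : Module.Dual K W ≃ₗ[K] W),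
      ∀ h ξ, e (ξ ∘ₗ ρ h⁻¹) = ρ (x h) (e ξ) := by
  classical
  by_contra hno
  push Not at hno
  let E : W ≃ₗ[K] Module.Dual K W := (Module.finBasis K W).toDualEquiv
  let σ : Representation K H W :=
    { toFun := fun h => E.symm.conj (ρ.dual h)
      map_one' := by rw [map_one]; ext; simp
      map_mul' := by intro a b; ext; simp [LinearEquiv.conj_apply]; rfl }
  have hσ : ∀ h w, σ h w = E.symm (E w ∘ₗ ρ h⁻¹) := by
    intro h w; rfl
  have hσtr : ∀ h, LinearMap.trace K W (σ h) = LinearMap.trace K W (ρ h⁻¹) := by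
    intro h
    change LinearMap.trace K W (E.symm.conj (ρ.dual h)) = _
    rw [LinearMap.trace_conj', Representation.dual_apply, LinearMap.trace_transpose']
  have hσirr : ∀ U : Submodule K W, (∀ h w, w ∈ U → σ h w ∈ U) → U = ⊥ ∨ U = ⊤ := by
    intro U hU
    have hD := hirr (U.map (E : W →ₗ[K] Module.Dual K W)).dualCoannihilator (by
      intro h w hw
      rw [Submodule.mem_dualCoannihilator] at hw ⊢
      rintro _ ⟨u, hu, rfl⟩
      have := hw (E (σ h⁻¹ u)) ⟨_, hU h⁻¹ u hu, rfl⟩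
      simpa [hσ] using this)
    have hdd := Subspace.dualCoannihilator_dualAnnihilator_eq
      (W := U.map (E : W →ₗ[K] Module.Dual K W))
    rcases hD with h | h
    · right
      rw [h, Submodule.dualAnnihilator_bot] at hdd
      rw [eq_top_iff]
      intro w _
      have : E w ∈ U.map (E : W →ₗ[K] Module.Dual K W) := hdd ▸ Submodule.mem_top
      obtain ⟨u, hu, hue⟩ := this
      exact E.injective hue ▸ hu
    · left
      rw [h, Submodule.dualAnnihilator_top] at hdd
      rw [eq_bot_iff]
      intro w hw
      have : E w ∈ (⊥ : Submodule K (Module.Dual K W)) := hdd ▸ ⟨w, hw, rfl⟩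
      simpa using this
  have hfin : Finite (MulAut H) := Finite.of_injective (fun x : MulAut H => (x : H → H))
    DFunLike.coe_injective
  have := Fintype.ofFinite (MulAut H)
  let F : MulAut H → (H → K) := fun x h => LinearMap.trace K W (ρ (x h))
  let O : Finset (H → K) := Finset.univ.image F
  have hO : ∀ f : O, ∃ x, F x = f.1 := by
    intro f
    obtain ⟨x, -, hx⟩ := Finset.mem_image.1 f.2
    exact ⟨x, hx⟩
  choose X hX using hO
  have hX' : ∀ f h, LinearMap.trace K W (ρ (X f h)) = f.1 h := fun f h => congrFun (hX f) h
  have hstab : ∀ f ∈ O, ∀ φ : MulAut H, (fun h => f (φ h)) ∈ O := by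
    intro f hf φ
    obtain ⟨x, -, hx⟩ := Finset.mem_image.1 hf
    refine Finset.mem_image.2 ⟨x * φ, Finset.mem_univ _, ?_⟩
    rw [← hx]; rfl
  have hsum : ∀ h, ∑ f ∈ O, f h⁻¹ = ∑ f ∈ O, f h := by
    intro h
    obtain ⟨φ, hφ⟩ := hconj h
    rw [← hφ]
    refine Finset.sum_nbij' (fun f h => f (φ h)) (fun f h => f (φ⁻¹ h)) ?_ ?_ ?_ ?_ ?_
    · intro f hf; exact hstab f hf φ
    · intro f hf; exact hstab f hf φ⁻¹
    · intro f hf; ext h; simp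
    · intro f hf; ext h; simp
    · intro f hf; rfl
  let r : O ⊕ O → Representation K H W :=
    Sum.elim (fun f => ρ.comp (X f : H →* H)) (fun f => σ.comp (X f : H →* H))
  have hcross : ∀ (x y : MulAut H) (e : W ≃ₗ[K] W), ¬ ∀ h w, e (σ (x h) w) = ρ (y h) (e w) := by
    intro x y e he
    obtain ⟨h, ξ, hh⟩ := hno (y * x⁻¹) (E.symm ≪≫ₗ e)
    apply hh
    have := he (x⁻¹ h) (E.symm ξ)
    simpa [hσ] using this
  have htrace : ∀ (a b : H → W →ₗ[K] W) (e : W ≃ₗ[K] W), (∀ h w, e (a h w) = b h (e w)) →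
      ∀ h, LinearMap.trace K W (a h) = LinearMap.trace K W (b h) := by
    intro a b e he h
    have : b h = e.conj (a h) := by
      ext w
      simp [LinearEquiv.conj_apply, he]
    rw [this, LinearMap.trace_conj']
  have hli := aux_li r (by
      rintro (f | f)
      · exact aux_irr ρ hirr _
      · exact aux_irr σ hσirr _) (by
      rintro (f | f) (g | g) hfg e he
      · apply hfg
        have := htrace (fun h => ρ (X f h)) (fun h => ρ (X g h)) e he
        simp only [hX'] at this
        congr 1
        exact Subtype.ext (funext this)
      · refine hcross (X g) (X f) e.symm ?_
        intro h w
        have := he h (e.symm w)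
        rw [← e.injective.eq_iff]
        simp only [LinearEquiv.apply_symm_apply] at this ⊢
        exact this.symm
      · exact hcross (X f) (X g) e he
      · apply hfg
        have := htrace (fun h => σ (X f h)) (fun h => σ (X g h)) e he
        simp only [hσtr, ← map_inv, hX'] at this
        congr 1
        refine Subtype.ext (funext fun h => ?_)
        simpa using this h⁻¹)
    (Sum.elim (fun _ => 1) (fun _ => -1)) (by
      intro h
      have h1 : ∀ f : O, LinearMap.trace K W (r (Sum.inl f) h) = f.1 h := fun f => hX' f h
      have h2 : ∀ f : O, LinearMap.trace K W (r (Sum.inr f) h) = f.1 h⁻¹ := by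
        intro f
        rw [← hX' f h⁻¹, map_inv]
        exact hσtr _
      simp only [Fintype.sum_sum_type, Sum.elim_inl, Sum.elim_inr, h1, h2, one_mul, neg_mul,
        Finset.sum_neg_distrib]
      rw [Finset.sum_coe_sort O (fun f => f h), Finset.sum_coe_sort O (fun f => f h⁻¹), hsum]
      simp)
    (Sum.inl ⟨F 1, Finset.mem_image_of_mem _ (Finset.mem_univ _)⟩)
  simp at hli

open TensorProduct in
/-- If every element of the finite group `H` is conjugate to its
inverse via an element of `Aut(H)`, and `V` is an irreducible `kH`-module, then the
dual module `V*` is isomorphic to a twist `V^x` of `V` by some automorphism `x` of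
`H`: there is a `k`-linear equivalence `e : V ≃ V*` with
`e (x h • v) = h • (e v)` for the contragredient action, i.e.
`(e (x h • v)) w = (e v) (h⁻¹ • w)`. -/
theorem stmt7 {k V H : Type*} [Field k] [AddCommGroup V] [Module k V]
    [Group H] [Finite H] [DistribMulAction H V] [SMulCommClass H k V]
    (hconj : ∀ h : H, ∃ φ : MulAut H, φ h = h⁻¹)
    [Nontrivial V]
    (hirr : ∀ W : Submodule k V, (∀ (h : H) (w : V), w ∈ W → h • w ∈ W) → W = ⊥ ∨ W = ⊤) :
    ∃ (x : MulAut H) (e : V ≃ₗ[k] (V →ₗ[k] k)),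
      ∀ (h : H) (v w : V), e (x h • v) w = e v (h⁻¹ • w) := by
  classical
  let ρ : H → V →ₗ[k] V := fun h => DistribSMul.toLinearMap k V h
  have hρ : ∀ h v, ρ h v = h • v := fun h v => rfl
  have hρ1 : ρ 1 = LinearMap.id := by ext v; simp [hρ]
  have hρm : ∀ a b, ρ (a * b) = ρ a ∘ₗ ρ b := by intro a b; ext v; simp [hρ, mul_smul]
  -- finite-dimensionality
  have hfd : FiniteDimensional k V := by
    obtain ⟨v, hv⟩ := exists_ne (0 : V)
    rcases hirr (Submodule.span k (Set.range fun h : H => h • v)) (by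
      intro h w hw
      have := Submodule.mem_map_of_mem (f := ρ h) hw
      rw [Submodule.map_span] at this
      refine Submodule.span_mono ?_ this
      rintro _ ⟨_, ⟨g, rfl⟩, rfl⟩
      exact ⟨h * g, by simp [hρ, mul_smul]⟩) with h | h
    · exfalso
      apply hv
      have : v ∈ Submodule.span k (Set.range fun h : H => h • v) :=
        Submodule.subset_span ⟨1, by simp⟩
      rw [h] at this
      simpa using this
    · exact ⟨h ▸ Submodule.fg_span (Set.finite_range _)⟩
  let K := AlgebraicClosure k
  let R : Representation K H (K ⊗[k] V) :=
    { toFun := fun h => (ρ h).baseChange K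
      map_one' := by rw [hρ1]; exact LinearMap.baseChange_id
      map_mul' := by intro a b; rw [hρm]; ext v; simp }
  have hR : ∀ h, R h = (ρ h).baseChange K := fun h => rfl
  have hnt : Nontrivial (K ⊗[k] V) := by
    have : 0 < Module.finrank K (K ⊗[k] V) := by
      rw [Module.finrank_baseChange]; exact Module.finrank_pos
    exact Module.nontrivial_of_finrank_pos this
  -- a minimal invariant subspace
  obtain ⟨W, ⟨hW0, hWinv⟩, hWmin⟩ := exists_minimal_of_wellFoundedLT
    (fun W : Submodule K (K ⊗[k] V) => W ≠ ⊥ ∧ ∀ h w, w ∈ W → R h w ∈ W)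
    ⟨⊤, top_ne_bot, fun _ _ _ => trivial⟩
  have hWnt : Nontrivial W := Submodule.nontrivial_iff_ne_bot.2 hW0
  let S : Representation K H W :=
    { toFun := fun h => (R h).restrict (hWinv h)
      map_one' := by ext w; simp
      map_mul' := by intro a b; ext w; simp }
  have hS : ∀ h (w : W), (S h w : K ⊗[k] V) = R h w := fun h w => rfl
  obtain ⟨x, e, he⟩ := aux_closed (K := K) (W := W) hconj S (by
    intro U hU
    by_cases hU0 : U = ⊥
    · exact Or.inl hU0
    right
    have := hWmin (y := U.map W.subtype) ⟨fun h0 => hU0 (Submodule.map_injective_of_injective W.injective_subtype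
      (h0.trans (Submodule.map_bot _).symm)), by
      rintro h _ ⟨u, hu, rfl⟩
      exact ⟨S h u, hU h u hu, rfl⟩⟩ (Submodule.map_subtype_le _ _)
    rw [eq_top_iff]
    intro w _
    obtain ⟨u, hu, huw⟩ := this w.2
    exact (Subtype.ext huw : u = w) ▸ hu)
  let b := Module.finBasis k V
  let bK := b.baseChange K
  -- extension of functionals and restriction to `W`
  let res : Module.Dual k V →ₗ[k] Module.Dual K W :=
    { toFun := fun ξ => (Module.Dual.baseChange K ξ) ∘ₗ W.subtype
      map_add' := by intro a b; ext w; simp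
      map_smul' := by intro a b; ext w; simp }
  have hres : ∀ ξ w, res ξ w = Module.Dual.baseChange K ξ (w : K ⊗[k] V) :=
    fun ξ w => rfl
  have hreseq : ∀ h ξ, res (ξ ∘ₗ ρ h⁻¹) = res ξ ∘ₗ S h⁻¹ := by
    intro h ξ
    ext w
    simp only [hres, LinearMap.comp_apply, hS, hR]
    generalize (w : K ⊗[k] V) = z
    induction z with
    | zero => simp
    | add x y hx hy => simp only [map_add, hx, hy]
    | tmul c v => simp
  have hcoord : ∀ i (z : K ⊗[k] V),
      Module.Dual.baseChange K (b.coord i) z = bK.repr z i := by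
    intro i z
    induction z with
    | zero => simp
    | add x y hx hy => simp [hx, hy]
    | tmul c v => simp [bK, Module.Basis.baseChange_repr_tmul]
  have hne : ∃ ξ, res ξ ≠ 0 := by
    obtain ⟨w, hw⟩ := exists_ne (0 : W)
    by_contra hall
    push Not at hall
    apply hw
    apply Subtype.ext
    apply bK.repr.injective
    ext i
    rw [← hcoord, ← hres, hall]
    simp
  obtain ⟨ξ, hξ⟩ := hne
  have heξ : ((e (res ξ) : W) : K ⊗[k] V) ≠ 0 := by simpa using hξ
  obtain ⟨i, hi⟩ : ∃ i, bK.repr (e (res ξ) : W) i ≠ 0 := by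
    by_contra hall
    push Not at hall
    apply heξ
    apply bK.repr.injective
    ext i
    simp [hall]
  obtain ⟨l, hl⟩ := Module.Projective.exists_dual_ne_zero k hi
  let q : K ⊗[k] V →ₗ[k] V := (TensorProduct.lid k V).toLinearMap ∘ₗ l.rTensor V
  have hq : ∀ h z, q (R h z) = ρ h (q z) := by
    intro h z
    rw [hR]
    induction z with
    | zero => simp
    | add x y hx hy => simp only [map_add, hx, hy]
    | tmul c v => simp [q]
  have hqr : ∀ z, b.repr (q z) i = l (bK.repr z i) := by
    intro z
    induction z with
    | zero => simp
    | add x y hx hy => simp [hx, hy]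
    | tmul c v => simp [q, bK, Module.Basis.baseChange_repr_tmul, mul_comm]
  let g : Module.Dual k V →ₗ[k] V :=
    q ∘ₗ (W.subtype.restrictScalars k) ∘ₗ (e.toLinearMap.restrictScalars k) ∘ₗ res
  have hg : ∀ ξ, g ξ = q (e (res ξ) : W) := fun ξ => rfl
  have hgeq : ∀ h ξ, g (ξ ∘ₗ ρ h⁻¹) = ρ (x h) (g ξ) := by
    intro h ξ
    rw [hg, hg, hreseq, he, hS, hq]
  have hg0 : g ξ ≠ 0 := by
    intro h0
    apply hl
    rw [← hqr, ← hg, h0]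
    simp
  have hsurj : Function.Surjective g := by
    rw [← LinearMap.range_eq_top]
    refine (hirr (LinearMap.range g) ?_).resolve_left ?_
    · rintro h _ ⟨η, rfl⟩
      refine ⟨η ∘ₗ ρ (x.symm h)⁻¹, ?_⟩
      rw [hgeq]
      simp [hρ]
    · intro hbot
      apply hg0
      have : g ξ ∈ LinearMap.range g := ⟨ξ, rfl⟩
      rw [hbot] at this
      simpa using this
  have hinj : Function.Injective g :=
    (LinearMap.injective_iff_surjective_of_finrank_eq_finrank
      (Subspace.dual_finrank_eq (K := k) (V := V))).2 hsurj
  let G := LinearEquiv.ofBijective g ⟨hinj, hsurj⟩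
  refine ⟨x, G.symm, ?_⟩
  intro h v w
  have : G.symm (x h • v) = (G.symm v) ∘ₗ ρ h⁻¹ := by
    rw [LinearEquiv.symm_apply_eq]
    change _ = g _
    rw [hgeq]
    change _ = ρ (x h) (G (G.symm v))
    simp [hρ]
  rw [this]
  rfl
end

section
/- Let H be a finite group in which every element is conjugate to its inverse via an element of Aut(H), and suppose H = AB is a coprime factorization (A, B proper subgroups with gcd(|H:A|,|H:B|)=1). If V is a non-trivial irreducible kH-module, then either A fixes no non-zero vector of V or B fixes no non-zero vector of V. -/
namespace Coprime8
open Matrix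

set_option linter.unusedSectionVars false

section core
variable {K R n : Type*} [Field K] [Ring R] [Algebra K R] [FiniteDimensional K R]
  [Fintype n] [DecidableEq n] [Nonempty n]

/-- A two-sided ideal of the same codimension as `ker F` but different from it maps onto
the matrix algebra. -/
lemma exists_map_eq_one (F : R →ₐ[K] Matrix n n K) (hF : Function.Surjective F)
    (N : Submodule K R) (hl : ∀ r x, x ∈ N → r * x ∈ N) (hr : ∀ r x, x ∈ N → x * r ∈ N)
    (hrank : Module.finrank K N = Module.finrank K (LinearMap.ker F.toLinearMap))
    (hne : N ≠ LinearMap.ker F.toLinearMap) : ∃ x ∈ N, F x = 1 := by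
  let I : TwoSidedIdeal (Matrix n n K) := TwoSidedIdeal.mk' {y | ∃ x ∈ N, F x = y}
    ⟨0, N.zero_mem, map_zero F⟩
    (by rintro _ _ ⟨x, hx, rfl⟩ ⟨y, hy, rfl⟩; exact ⟨x + y, N.add_mem hx hy, map_add F _ _⟩)
    (by rintro _ ⟨x, hx, rfl⟩; exact ⟨-x, N.neg_mem hx, map_neg F _⟩)
    (by
      rintro a _ ⟨y, hy, rfl⟩
      obtain ⟨r, rfl⟩ := hF a
      exact ⟨r * y, hl _ _ hy, map_mul F _ _⟩)
    (by
      rintro _ a ⟨y, hy, rfl⟩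
      obtain ⟨r, rfl⟩ := hF a
      exact ⟨y * r, hr _ _ hy, map_mul F _ _⟩)
  have hI : ∀ y, y ∈ I ↔ ∃ x ∈ N, F x = y := fun y => by
    simp [I, TwoSidedIdeal.mem_mk']
  rcases eq_bot_or_eq_top I with h | h
  · exfalso
    apply hne
    apply Submodule.eq_of_le_of_finrank_eq _ hrank
    intro x hx
    have : F x ∈ I := (hI _).2 ⟨x, hx, rfl⟩
    rw [h, TwoSidedIdeal.mem_bot] at this
    simpa using this
  · exact (hI 1).1 (by rw [h]; trivial)

lemma exists_forall_mem_map_eq_one (F : R →ₐ[K] Matrix n n K) (hF : Function.Surjective F)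
    (s : Finset (Submodule K R))
    (hl : ∀ N ∈ s, ∀ r x, x ∈ N → r * x ∈ N) (hr : ∀ N ∈ s, ∀ r x, x ∈ N → x * r ∈ N)
    (hrank : ∀ N ∈ s, Module.finrank K N = Module.finrank K (LinearMap.ker F.toLinearMap))
    (hne : ∀ N ∈ s, N ≠ LinearMap.ker F.toLinearMap) : ∃ x, (∀ N ∈ s, x ∈ N) ∧ F x = 1 := by
  classical
  induction s using Finset.induction_on with
  | empty => exact ⟨1, by simp, map_one F⟩
  | insert N s hN ih =>
    simp only [Finset.forall_mem_insert] at hl hr hrank hne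
    obtain ⟨x, hx, hx1⟩ := ih hl.2 hr.2 hrank.2 hne.2
    obtain ⟨y, hy, hy1⟩ := exists_map_eq_one F hF N hl.1 hr.1 hrank.1 hne.1
    refine ⟨y * x, ?_, by simp [hx1, hy1]⟩
    intro M hM
    rcases Finset.mem_insert.1 hM with rfl | hM
    · exact hr.1 _ _ hy
    · exact hl.2 M hM _ _ (hx M hM)

/-- Surjections with the same kernel have the same trace (Skolem-Noether). -/
lemma trace_eq_of_ker_eq (F G : R →ₐ[K] Matrix n n K) (hF : Function.Surjective F)
    (hG : Function.Surjective G) (h : ∀ x, F x = 0 ↔ G x = 0) (x : R) :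
    (F x).trace = (G x).trace := by
  have hk : RingHom.ker F = RingHom.ker G := by ext x; simpa [RingHom.mem_ker] using h x
  let e : Matrix n n K ≃ₐ[K] Matrix n n K :=
    (Ideal.quotientKerAlgEquivOfSurjective hF).symm.trans
      ((Ideal.quotientEquivAlgOfEq K hk).trans (Ideal.quotientKerAlgEquivOfSurjective hG))
  have he : e (F x) = G x := by
    have : (Ideal.quotientKerAlgEquivOfSurjective hF).symm (F x) = Ideal.Quotient.mk _ x := by
      rw [AlgEquiv.symm_apply_eq]; rfl
    simp only [e, AlgEquiv.trans_apply, this]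
    rfl
  rw [← he]
  exact (Matrix.trace_map e (F x)).symm

lemma finrank_ker_comp (F : R →ₐ[K] Matrix n n K) (e : R ≃ₗ[K] R) :
    Module.finrank K (LinearMap.ker (F.toLinearMap ∘ₗ e.toLinearMap)) =
      Module.finrank K (LinearMap.ker F.toLinearMap) := by
  rw [LinearMap.ker_comp]
  rw [Submodule.comap_equiv_eq_map_symm]
  exact LinearEquiv.finrank_map_eq _ _

theorem exists_ker_eq {Γ : Type*} [Group Γ] [Finite Γ] (φ : Γ →* (R ≃ₐ[K] R))
    (ι : R ≃ₗ[K] R) (hι : ∀ x y, ι (x * y) = ι y * ι x)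
    (hc : ∀ g x, φ g (ι x) = ι (φ g x))
    (hτ : ∀ τ : R →ₗ[K] K, (∀ g x, τ (φ g x) = τ x) → ∀ x, τ (ι x) = τ x)
    (F : R →ₐ[K] Matrix n n K) (hF : Function.Surjective F) :
    ∃ g, ∀ x, F (φ g x) = 0 ↔ F (ι x) = 0 := by
  classical
  have := Fintype.ofFinite Γ
  by_contra! hcon
  have hcon' : ∀ g, ¬ ∀ x, F (φ g x) = 0 ↔ F (ι x) = 0 := by
    intro g hg
    obtain ⟨x, hx⟩ := hcon g
    have := hg x
    tauto
  let c : Γ → (R →ₗ[K] K) := fun g =>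
    Matrix.traceLinearMap n K K ∘ₗ F.toLinearMap ∘ₗ (φ g).toLinearMap
  have hc_app : ∀ g x, c g x = (F (φ g x)).trace := fun g x => rfl
  let X : Finset (R →ₗ[K] K) := Finset.univ.image c
  let τ : R →ₗ[K] K := ∑ χ ∈ X, χ
  have hτapp : ∀ x, τ x = ∑ χ ∈ X, χ x := fun x => by simp [τ]
  have hinv : ∀ g x, τ (φ g x) = τ x := by
    intro g x
    rw [hτapp, hτapp]
    have hmem : ∀ h : Γ, ∀ χ ∈ X, χ ∘ₗ (φ h).toLinearMap ∈ X := by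
      intro h χ hχ
      obtain ⟨g', -, rfl⟩ := Finset.mem_image.1 hχ
      refine Finset.mem_image.2 ⟨g' * h, Finset.mem_univ _, ?_⟩
      ext y
      simp [hc_app]
    refine Finset.sum_bij' (fun χ _ => χ ∘ₗ (φ g).toLinearMap)
      (fun χ _ => χ ∘ₗ (φ g⁻¹).toLinearMap) (hmem g) (hmem g⁻¹) ?_ ?_ ?_
    · intro χ _; ext y; simp
    · intro χ _; ext y; simp
    · intro χ _; rfl
  let N1 : Γ → Submodule K R := fun g =>
    LinearMap.ker (F.toLinearMap ∘ₗ (ι.trans (φ g).toLinearEquiv).toLinearMap)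
  let N2 : Γ → Submodule K R := fun g =>
    LinearMap.ker (F.toLinearMap ∘ₗ ((φ g).toLinearEquiv).toLinearMap)
  have hN1 : ∀ g x, x ∈ N1 g ↔ F (φ g (ι x)) = 0 := fun g x => Iff.rfl
  have hN2 : ∀ g x, x ∈ N2 g ↔ F (φ g x) = 0 := fun g x => Iff.rfl
  let s : Finset (Submodule K R) := Finset.univ.image N1 ∪
    (Finset.univ.image N2).filter (fun N => N ≠ LinearMap.ker F.toLinearMap)
  have hs : ∀ N ∈ s, (∃ g, N = N1 g) ∨ (∃ g, N = N2 g) := by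
    intro N hN
    rcases Finset.mem_union.1 hN with h | h
    · obtain ⟨g, -, rfl⟩ := Finset.mem_image.1 h; exact Or.inl ⟨g, rfl⟩
    · obtain ⟨g, -, rfl⟩ := Finset.mem_image.1 (Finset.mem_filter.1 h).1; exact Or.inr ⟨g, rfl⟩
  obtain ⟨x, hx, hx1⟩ := exists_forall_mem_map_eq_one F hF s
    (by
      intro N hN r x hxN
      rcases hs N hN with ⟨g, rfl⟩ | ⟨g, rfl⟩
      · rw [hN1] at *; simp [hι, hxN]
      · rw [hN2] at *; simp [hxN])
    (by
      intro N hN r x hxN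
      rcases hs N hN with ⟨g, rfl⟩ | ⟨g, rfl⟩
      · rw [hN1] at *; simp [hι, hxN]
      · rw [hN2] at *; simp [hxN])
    (by
      intro N hN
      rcases hs N hN with ⟨g, rfl⟩ | ⟨g, rfl⟩
      · exact finrank_ker_comp F _
      · exact finrank_ker_comp F _)
    (by
      intro N hN
      rcases Finset.mem_union.1 hN with h | h
      · obtain ⟨g, -, rfl⟩ := Finset.mem_image.1 h
        intro heq
        apply hcon' g⁻¹
        intro y
        have h1 : φ g⁻¹ y ∈ N1 g ↔ φ g⁻¹ y ∈ LinearMap.ker F.toLinearMap := by rw [heq]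
        rw [hN1, hc, ← AlgEquiv.mul_apply, ← map_mul] at h1
        simpa using h1.symm
      · exact (Finset.mem_filter.1 h).2)
  obtain ⟨i⟩ := ‹Nonempty n›
  obtain ⟨y, hy⟩ := hF (Matrix.single i i 1)
  have h1 : ∀ g, F (φ g (ι x)) = 0 := fun g =>
    (hN1 g x).1 (hx _ (Finset.mem_union_left _ (Finset.mem_image_of_mem _ (Finset.mem_univ _))))
  have h0 : τ (ι (x * y)) = 0 := by
    rw [hτapp]
    refine Finset.sum_eq_zero fun χ hχ => ?_
    obtain ⟨g, -, rfl⟩ := Finset.mem_image.1 hχ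
    simp [hc_app, hι, h1]
  have h2 : τ (x * y) = 1 := by
    rw [hτapp, Finset.sum_eq_single (c 1)]
    · simp [hc_app, hx1, hy]
    · intro χ hχ hne
      obtain ⟨g, -, rfl⟩ := Finset.mem_image.1 hχ
      have hk : N2 g ≠ LinearMap.ker F.toLinearMap := by
        intro heq
        apply hne
        ext z
        have := trace_eq_of_ker_eq (F.comp (φ g : R →ₐ[K] R)) F (hF.comp (φ g).surjective) hF (by
          intro w
          have : w ∈ N2 g ↔ w ∈ LinearMap.ker F.toLinearMap := by rw [heq]
          simpa [hN2] using this) z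
        simpa [hc_app] using this
      have : F (φ g x) = 0 := (hN2 g x).1 (hx _ (Finset.mem_union_right _
        (Finset.mem_filter.2 ⟨Finset.mem_image_of_mem _ (Finset.mem_univ _), hk⟩)))
      simp [hc_app, this]
    · intro h
      exact absurd (Finset.mem_image_of_mem _ (Finset.mem_univ _)) h
  rw [hτ τ hinv, h2] at h0
  exact one_ne_zero h0

end core
section grp
variable {H : Type*} [Group H] [Finite H]

lemma exists_mul_of_coprime (A B : Subgroup H) (h : Nat.Coprime A.index B.index) (x : H) :
    ∃ b ∈ B, ∃ a ∈ A, x = b * a := by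
  have h1 : A.index ∣ A.relIndex B := by
    apply h.dvd_of_dvd_mul_right
    have : A.relIndex B * B.index = (A ⊓ B).index := by
      rw [← Subgroup.inf_relIndex_right]
      exact Subgroup.relIndex_mul_index inf_le_right
    rw [this]
    exact Subgroup.index_dvd_of_le inf_le_left
  have hst : MulAction.stabilizer B ((1 : H) : H ⧸ A) = A.subgroupOf B := by
    ext b
    rw [MulAction.mem_stabilizer_iff, Subgroup.mem_subgroupOf]
    change (((b : H) * 1 : H) : H ⧸ A) = _ ↔ _
    rw [eq_comm, QuotientGroup.eq]
    simp
  have h2 := MulAction.index_stabilizer B ((1 : H) : H ⧸ A)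
  rw [hst] at h2
  have h3 : MulAction.orbit B ((1 : H) : H ⧸ A) = Set.univ := by
    apply Set.eq_of_subset_of_ncard_le (Set.subset_univ _) _ (Set.toFinite _)
    rw [Set.ncard_univ, ← h2]
    exact Nat.le_of_dvd (Nat.pos_of_ne_zero Subgroup.FiniteIndex.index_ne_zero) h1
  have h4 : (x : H ⧸ A) ∈ MulAction.orbit B ((1 : H) : H ⧸ A) := by rw [h3]; trivial
  obtain ⟨b, hb⟩ := h4
  change (((b : H) * 1 : H) : H ⧸ A) = _ at hb
  rw [QuotientGroup.eq] at hb
  exact ⟨b, b.2, _, hb, by simp⟩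

variable (K : Type*) [Field K]

/-- Inversion on the group algebra as an antihomomorphism. -/
noncomputable def invHom : MonoidAlgebra K H →ₗ[K] MonoidAlgebra K H :=
  (MulOpposite.opLinearEquiv K).symm.toLinearMap ∘ₗ
    (MonoidAlgebra.lift K (MonoidAlgebra K H)ᵐᵒᵖ H
      { toFun := fun h => MulOpposite.op (MonoidAlgebra.of K H h⁻¹)
        map_one' := by rw [inv_one, map_one, MulOpposite.op_one]
        map_mul' := fun x y => by
          rw [_root_.mul_inv_rev, map_mul, MulOpposite.op_mul] }).toLinearMap

lemma invHom_of (h : H) : invHom K (MonoidAlgebra.of K H h) = MonoidAlgebra.of K H h⁻¹ := by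
  simp [invHom]

lemma invHom_mul (x y : MonoidAlgebra K H) :
    invHom K (x * y) = invHom K y * invHom K x := by
  simp [invHom]

lemma lin_ext {M : Type*} [AddCommGroup M] [Module K M] (f g : MonoidAlgebra K H →ₗ[K] M)
    (h : ∀ x, f (MonoidAlgebra.of K H x) = g (MonoidAlgebra.of K H x)) : f = g := by
  apply MonoidAlgebra.lhom_ext'
  intro a
  ext
  simpa using h a

lemma invHom_invHom (x : MonoidAlgebra K H) : invHom K (invHom K x) = x := by
  have := lin_ext K (invHom K ∘ₗ invHom K (H := H)) LinearMap.id (fun x => by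
    simp only [LinearMap.comp_apply, invHom_of, inv_inv, LinearMap.id_apply])
  exact congr($this x)

/-- Inversion as a linear equivalence. -/
noncomputable def invEquiv : MonoidAlgebra K H ≃ₗ[K] MonoidAlgebra K H :=
  LinearEquiv.ofInvolutive (invHom K) (invHom_invHom K)

lemma invEquiv_apply (x : MonoidAlgebra K H) : invEquiv K x = invHom K x := rfl

variable {n : Type*} [Fintype n] [DecidableEq n]

variable {K} in
lemma no_sandwich (F : MonoidAlgebra K H →ₐ[K] Matrix n n K) (hF : Function.Surjective F)
    (hnt : ∃ h, F (MonoidAlgebra.of K H h) ≠ 1) (Z X : Matrix n n K) (hZ : Z ≠ 0) (hX : X ≠ 0)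
    (h : ∀ p, Z * F (MonoidAlgebra.of K H p) * X = Z * X) : False := by
  obtain ⟨g, hg⟩ := hnt
  set d := F (MonoidAlgebra.of K H g) - 1 with hd
  have hd0 : d ≠ 0 := sub_ne_zero.2 hg
  have h1 : ∀ p q, Z * F (MonoidAlgebra.of K H p) * d * F (MonoidAlgebra.of K H q) * X = 0 := by
    intro p q
    have e1 := h (p * g * q)
    have e2 := h (p * q)
    rw [map_mul, map_mul, map_mul, map_mul] at e1
    rw [map_mul, map_mul] at e2
    have : Z * F (MonoidAlgebra.of K H p) * d * F (MonoidAlgebra.of K H q) * X =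
      Z * (F (MonoidAlgebra.of K H p) * F (MonoidAlgebra.of K H g) * F (MonoidAlgebra.of K H q)) * X
      - Z * (F (MonoidAlgebra.of K H p) * F (MonoidAlgebra.of K H q)) * X := by
      rw [hd]; noncomm_ring
    rw [this, e1, e2, sub_self]
  have h2 : ∀ x q, Z * F x * d * F (MonoidAlgebra.of K H q) * X = 0 := by
    intro x q
    have := lin_ext K (LinearMap.mulRight K (d * F (MonoidAlgebra.of K H q) * X) ∘ₗ
      LinearMap.mulLeft K Z ∘ₗ F.toLinearMap) 0 (fun p => by
        simpa [mul_assoc] using h1 p q)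
    have := congr($this x)
    simpa [mul_assoc] using this
  have h3 : ∀ x y, Z * F x * d * F y * X = 0 := by
    intro x y
    have := lin_ext K (LinearMap.mulRight K X ∘ₗ
      LinearMap.mulLeft K (Z * F x * d) ∘ₗ F.toLinearMap) 0 (fun q => by
        simpa [mul_assoc] using h2 x q)
    have := congr($this y)
    simpa [mul_assoc] using this
  have hent : ∀ M : Matrix n n K, M ≠ 0 → ∃ i j, M i j ≠ 0 := by
    intro M hM
    by_contra! hc
    exact hM (by ext i j; exact hc i j)
  obtain ⟨i, j, hij⟩ := hent Z hZ
  obtain ⟨a, b, hab⟩ := hent d hd0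
  obtain ⟨r, s, hrs⟩ := hent X hX
  obtain ⟨x, hx⟩ := hF (Matrix.single j a 1)
  obtain ⟨y, hy⟩ := hF (Matrix.single b r 1)
  have h4 := congr($(h3 x y) i s)
  rw [hx, hy] at h4
  have h5 : (Z * (Matrix.single j a 1 : Matrix n n K) * d *
      (Matrix.single b r 1 : Matrix n n K) * X : Matrix n n K) i s = Z i j * d a b * X r s := by
    rw [Matrix.mul_apply, Finset.sum_eq_single r]
    · rw [Matrix.mul_single_apply_same, mul_one, Matrix.mul_apply, Finset.sum_eq_single a]
      · rw [Matrix.mul_single_apply_same, mul_one]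
      · intro c _ hc
        rw [Matrix.mul_single_apply_of_ne _ _ _ _ _ hc, zero_mul]
      · simp
    · intro c _ hc
      rw [Matrix.mul_single_apply_of_ne _ _ _ _ _ hc, zero_mul]
    · simp
  rw [h5] at h4
  exact mul_ne_zero (mul_ne_zero hij hab) hrs h4

variable {K} in
theorem matrix_case (hconj : ∀ h : H, ∃ φ : MulAut H, φ h = h⁻¹) (A B : Subgroup H)
    (hcop : Nat.Coprime A.index B.index)
    (F : MonoidAlgebra K H →ₐ[K] Matrix n n K) (hF : Function.Surjective F)
    (hnt : ∃ h, F (MonoidAlgebra.of K H h) ≠ 1) (v w : n → K) (hv : v ≠ 0) (hw : w ≠ 0)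
    (hvA : ∀ a ∈ A, F (MonoidAlgebra.of K H a) *ᵥ v = v)
    (hwB : ∀ b ∈ B, F (MonoidAlgebra.of K H b) *ᵥ w = w) : False := by
  have hne : Nonempty n := by
    by_contra hc
    rw [not_nonempty_iff] at hc
    exact hv (Subsingleton.elim _ _)
  have : Finite (MulAut H) := Finite.of_injective (fun φ : MulAut H => (φ : H → H))
    DFunLike.coe_injective
  let Φ : MulAut H →* (MonoidAlgebra K H ≃ₐ[K] MonoidAlgebra K H) := MonoidAlgebra.domCongrAut
  have hdom : ∀ (g : MulAut H) h, Φ g (MonoidAlgebra.of K H h) =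
      MonoidAlgebra.of K H (g h) := fun g h => by simp [Φ]
  have hfd : FiniteDimensional K (MonoidAlgebra K H) := inferInstance
  obtain ⟨g, hg⟩ := exists_ker_eq Φ (invEquiv K)
    (fun x y => invHom_mul K x y)
    (by
      intro g x
      have := lin_ext K ((Φ g).toLinearMap ∘ₗ invHom K)
        (invHom K ∘ₗ (Φ g).toLinearMap) (fun h => by
          simp only [LinearMap.comp_apply, invHom_of, AlgEquiv.toLinearMap_apply, hdom, map_inv])
      exact congr($this x))
    (by
      intro τ hτ x
      have := lin_ext K (τ ∘ₗ invHom K) τ (fun h => by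
        obtain ⟨φ, hφ⟩ := hconj h
        rw [LinearMap.comp_apply, invHom_of, ← hφ, ← hdom, hτ])
      exact congr($this x)) F hF
  obtain ⟨i⟩ := hne
  have hvm : ∀ (u : n → K), u ≠ 0 → Matrix.vecMulVec u (Pi.single i (1 : K)) ≠ 0 := by
    intro u hu h0
    apply hu
    ext j
    have := congr($h0 j i)
    simpa [Matrix.vecMulVec_apply] using this
  obtain ⟨y, hy⟩ := hF (Matrix.vecMulVec w (Pi.single i 1))
  let z := Φ g⁻¹ y
  have hz : Φ g z = y := by
    change (Φ g * Φ g⁻¹) y = y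
    rw [← map_mul]; simp
  have hZ : F (invEquiv K z) ≠ 0 := by
    rw [Ne, ← hg, hz, hy]
    exact hvm w hw
  have hZB : ∀ b ∈ B.comap (g : H →* H),
      F (invEquiv K z) * F (MonoidAlgebra.of K H b) = F (invEquiv K z) := by
    intro b hb
    have hb' : g b⁻¹ ∈ B := by rw [map_inv]; exact B.inv_mem hb
    have h1 := (hg (MonoidAlgebra.of K H b⁻¹ * z - z)).1 (by
      rw [map_sub, map_mul, hz, hdom, map_sub, map_mul, hy, Matrix.mul_vecMulVec, hwB _ hb',
        sub_self])
    rw [map_sub, invEquiv_apply, invHom_mul, invHom_of, inv_inv, map_sub, map_mul] at h1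
    exact sub_eq_zero.1 h1
  refine no_sandwich F hF hnt (F (invEquiv K z)) (Matrix.vecMulVec v (Pi.single i 1)) hZ
    (hvm v hv) ?_
  intro p
  have hidx : (B.comap (g : H →* H)).index = B.index :=
    Subgroup.index_comap_of_surjective B g.surjective
  obtain ⟨b, hb, a, ha, rfl⟩ := exists_mul_of_coprime A (B.comap (g : H →* H))
    (by rw [hidx]; exact hcop) p
  rw [map_mul, map_mul, ← mul_assoc, hZB b hb, mul_assoc, Matrix.mul_vecMulVec, hvA a ha]

end grp
section red
open scoped TensorProduct
variable {k V H : Type*} [Field k] [AddCommGroup V] [Module k V]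
    [Group H] [Finite H] [DistribMulAction H V] [SMulCommClass H k V]

lemma finite_of_irr (hnt : ∃ (h : H) (v : V), h • v ≠ v)
    (hirr : ∀ W : Submodule k V, (∀ (h : H) (w : V), w ∈ W → h • w ∈ W) → W = ⊥ ∨ W = ⊤) :
    FiniteDimensional k V := by
  obtain ⟨h0, v, hv⟩ := hnt
  have hv0 : v ≠ 0 := by rintro rfl; simp at hv
  have hfin : (Set.range (fun h : H => h • v)).Finite := Set.finite_range _
  rcases hirr (Submodule.span k (Set.range (fun h : H => h • v))) (by
    intro h w hw
    induction hw using Submodule.span_induction with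
    | mem x hx =>
      obtain ⟨g, rfl⟩ := hx
      exact Submodule.subset_span ⟨h * g, by simp [mul_smul]⟩
    | zero => simp
    | add x y _ _ hx hy => rw [smul_add]; exact Submodule.add_mem _ hx hy
    | smul c x _ hx => rw [smul_comm]; exact Submodule.smul_mem _ _ hx) with h | h
  · exfalso
    have : v ∈ Submodule.span k (Set.range (fun h : H => h • v)) :=
      Submodule.subset_span ⟨1, by simp⟩
    rw [h] at this
    exact hv0 (by simpa using this)
  · exact ⟨⟨hfin.toFinset, by simpa using h⟩⟩

/-- Burnside: a finite-dimensional simple module over an algebra over an algebraically closed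
field has surjective structure map. -/
lemma lsmul_surjective {K R W : Type*} [Field K] [IsAlgClosed K] [Ring R] [Algebra K R]
    [AddCommGroup W] [Module K W] [Module R W] [IsScalarTower K R W] [IsSimpleModule R W]
    [FiniteDimensional K W] :
    Function.Surjective (Algebra.lsmul K K W : R →ₐ[K] Module.End K W) := by
  intro f
  let f' : Module.End (Module.End R W) W :=
    { toFun := f
      map_add' := map_add f
      map_smul' := fun e x => by
        obtain ⟨c, rfl⟩ := (IsSimpleModule.algebraMap_end_bijective_of_isAlgClosed
          (A := R) (V := W) K).2 e
        simp }
  let b := Module.finBasis K W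
  classical
  obtain ⟨r, hr⟩ := jacobson_density f' (Finset.univ.image b)
  refine ⟨r, b.ext fun i => ?_⟩
  exact (hr (b i) (Finset.mem_image_of_mem _ (Finset.mem_univ _))).symm

theorem main (hconj : ∀ h : H, ∃ φ : MulAut H, φ h = h⁻¹)
    (A B : Subgroup H) (hcop : Nat.Coprime A.index B.index)
    (hnt : ∃ (h : H) (v : V), h • v ≠ v)
    (hirr : ∀ W : Submodule k V, (∀ (h : H) (w : V), w ∈ W → h • w ∈ W) → W = ⊥ ∨ W = ⊤)
    (v w : V) (hv : v ≠ 0) (hw : w ≠ 0) (hvA : ∀ a ∈ A, a • v = v) (hwB : ∀ b ∈ B, b • w = w) :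
    False := by
  have hfd := finite_of_irr hnt hirr
  let K := AlgebraicClosure k
  let ρ : Representation K H (K ⊗[k] V) :=
    { toFun := fun h => (DistribSMul.toLinearMap k V h).baseChange K
      map_one' := by
        ext x; simp
      map_mul' := fun g h => by
        ext x; simp [mul_smul] }
  have hρ : ∀ h x, ρ h ((1 : K) ⊗ₜ[k] x) = 1 ⊗ₜ (h • x) := fun h x => by simp [ρ]
  let R := MonoidAlgebra K H
  let E := K ⊗[k] V
  let iM : Module R E := Module.compHom E ρ.asAlgebraHom.toRingHom
  have hsm : ∀ (r : R) (x : E), r • x = ρ.asAlgebraHom r x := fun r x => rfl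
  have hST : IsScalarTower K R E := ⟨fun c r x => by rw [hsm, hsm, map_smul]; rfl⟩
  obtain ⟨h0, v0, hv0⟩ := hnt
  have : Nontrivial V := ⟨_, _, hv⟩
  have hnE : Nontrivial (K ⊗[k] V) := inferInstance
  have : Nontrivial E := hnE
  have hfE : Module.Finite K E := inferInstance
  have hfR : Module.Finite R E := Module.Finite.of_restrictScalars_finite K R E
  obtain ⟨m, hm, -⟩ := (eq_top_or_exists_le_coatom (⊥ : Submodule R E)).resolve_left bot_ne_top
  have hs : IsSimpleModule R (E ⧸ m) := isSimpleModule_iff_isCoatom.2 hm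
  let W := E ⧸ m
  have hfW : Module.Finite K W := Module.Finite.of_surjective ((m.mkQ).restrictScalars K)
    m.mkQ_surjective
  -- the map from `V` to `W`
  let j : V →ₗ[k] E := TensorProduct.mk k K V 1
  let q : V → W := fun x => m.mkQ (j x)
  have hq_add : ∀ x y, q (x + y) = q x + q y := fun x y => by simp [q]
  have hjh : ∀ (h : H) x, MonoidAlgebra.of K H h • j x = j (h • x) := by
    intro h x
    have : ρ.asAlgebraHom (MonoidAlgebra.of K H h) (j x) = j (h • x) := by
      rw [Representation.asAlgebraHom_of]; exact hρ h x
    exact this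
  have hqh : ∀ (h : H) x, MonoidAlgebra.of K H h • q x = q (h • x) := by
    intro h x
    simp only [q]
    rw [← map_smul, hjh]
  let N : Submodule k V :=
    { carrier := {x | j x ∈ m}
      zero_mem' := by simp
      add_mem' := fun {x y} hx hy => by
        simp only [Set.mem_ofPred_eq, map_add] at *; exact m.add_mem hx hy
      smul_mem' := fun c x hx => by
        simp only [Set.mem_ofPred_eq] at *
        have : j (c • x) = (algebraMap K R (algebraMap k K c)) • j x := by
          rw [algebraMap_smul, map_smul, algebraMap_smul]
        rw [this]
        exact m.smul_mem _ hx }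
  have hN : N = ⊥ := by
    refine (hirr N ?_).resolve_right ?_
    · intro h x hx
      change j (h • x) ∈ m
      rw [← hjh]
      exact m.smul_mem _ hx
    · intro htop
      apply hm.1
      rw [eq_top_iff]
      intro e _
      have : ∀ e : K ⊗[k] V, (e : E) ∈ m := by
        intro e
        induction e using TensorProduct.induction_on with
        | zero => exact m.zero_mem
        | add x y hx hy => exact m.add_mem hx hy
        | tmul c x =>
          have hx : j x ∈ m := by
            have : x ∈ N := by rw [htop]; trivial
            exact this
          have h1 : (algebraMap K R c) • j x ∈ m := m.smul_mem _ hx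
          rw [algebraMap_smul] at h1
          have h2 : c • j x = (c ⊗ₜ[k] x : K ⊗[k] V) := by
            change c • ((1 : K) ⊗ₜ[k] x) = _
            rw [TensorProduct.smul_tmul', smul_eq_mul, mul_one]
          rwa [h2] at h1
      exact this e
  have hq0 : ∀ x, q x = 0 → x = 0 := by
    intro x hx
    have : x ∈ N := (Submodule.Quotient.mk_eq_zero m).1 hx
    rw [hN] at this
    simpa using this
  let b := Module.finBasis K W
  let F : R →ₐ[K] Matrix (Fin (Module.finrank K W)) (Fin (Module.finrank K W)) K :=
    (LinearMap.toMatrixAlgEquiv b).toAlgHom.comp (Algebra.lsmul K K W)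
  have hF : Function.Surjective F :=
    (LinearMap.toMatrixAlgEquiv b).surjective.comp lsmul_surjective
  have hFv : ∀ (r : R) (x : W), F r *ᵥ (b.repr x) = b.repr (r • x) := by
    intro r x
    exact LinearMap.toMatrix_mulVec_repr b b (Algebra.lsmul K K W r) x
  have hne : ∀ x : V, x ≠ 0 → (b.repr (q x) : _ → K) ≠ 0 := by
    intro x hx h
    apply hx
    apply hq0
    apply b.repr.injective
    rw [map_zero]
    exact DFunLike.coe_injective h
  refine matrix_case hconj A B hcop F hF ⟨h0, ?_⟩ (b.repr (q v)) (b.repr (q w)) (hne v hv)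
    (hne w hw) ?_ ?_
  · intro h1
    have h2 := hFv (MonoidAlgebra.of K H h0) (q v0)
    rw [h1, Matrix.one_mulVec, hqh] at h2
    have h3 : q v0 = q (h0 • v0) := b.repr.injective (DFunLike.coe_injective h2)
    apply hv0
    rw [← sub_eq_zero]
    apply hq0
    rw [sub_eq_add_neg, hq_add, ← h3, ← hq_add, add_neg_cancel]
    simp [q]
  · intro a ha
    rw [hFv, hqh, hvA a ha]
  · intro a ha
    rw [hFv, hqh, hwB a ha]

end red
end Coprime8

/-- Let `H` be a finite group in which every element is conjugate to
its inverse via an automorphism, and let `H = AB` be a coprime factorization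
(`A`, `B` proper, `gcd(|H:A|,|H:B|) = 1`).  If `V` is a non-trivial irreducible
`kH`-module, then either `A` fixes no non-zero vector of `V` or `B` fixes no
non-zero vector of `V`. -/
theorem stmt8 {k V H : Type*} [Field k] [AddCommGroup V] [Module k V]
    [Group H] [Finite H] [DistribMulAction H V] [SMulCommClass H k V]
    (hconj : ∀ h : H, ∃ φ : MulAut H, φ h = h⁻¹)
    (A B : Subgroup H) (hA : A ≠ ⊤) (hB : B ≠ ⊤)
    (hAB : ∀ h : H, ∃ a ∈ A, ∃ b ∈ B, h = a * b)
    (hcop : Nat.Coprime A.index B.index)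
    (hnt : ∃ (h : H) (v : V), h • v ≠ v)
    (hirr : ∀ W : Submodule k V, (∀ (h : H) (w : V), w ∈ W → h • w ∈ W) → W = ⊥ ∨ W = ⊤) :
    (∀ v : V, v ≠ 0 → ∃ g ∈ A, g • v ≠ v) ∨ (∀ v : V, v ≠ 0 → ∃ g ∈ B, g • v ≠ v) := by
  by_contra hcon
  push Not at hcon
  obtain ⟨⟨v, hv, hvA⟩, w, hw, hwB⟩ := hcon
  exact Coprime8.main hconj A B hcop hnt hirr v w hv hw hvA hwB
end

section
/- Every element of the symplectic group Sp(2n,q) is conjugate to its inverse inside the conformal symplectic group CSp(2n,q), for n ≥ 2. -/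
open Matrix
open Polynomial

section
variable {F : Type*} [Field F] {V : Type*} [AddCommGroup V] [Module F V]

lemma poly_dich {p : F[X]} (hp : Irreducible p) {k : ℕ} (hk : 0 < k) (g : F[X]) :
    p ^ k ∣ g ∨ ∃ a b, a * g + b * p ^ k = p ^ (k - 1) := by
  classical
  have h1 : EuclideanDomain.gcd g (p ^ k) ∣ p ^ k := EuclideanDomain.gcd_dvd_right _ _
  obtain ⟨i, hi, hd⟩ := (dvd_prime_pow hp.prime k).1 h1
  rcases hi.lt_or_eq with h | h
  · right
    have h2 : EuclideanDomain.gcd g (p ^ k) ∣ p ^ (k - 1) :=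
      hd.dvd.trans (pow_dvd_pow p (by omega))
    obtain ⟨c, hc⟩ := h2
    rw [EuclideanDomain.gcd_eq_gcd_ab] at hc
    exact ⟨EuclideanDomain.gcdA g (p ^ k) * c, EuclideanDomain.gcdB g (p ^ k) * c, by rw [hc]; ring⟩
  · left
    subst h
    exact hd.symm.dvd.trans (EuclideanDomain.gcd_dvd_left _ _)

/-- `(f, g) ↦ f(A) v + g(A) w` -/
noncomputable def cyc (A : Module.End F V) (v w : V) : F[X] × F[X] →ₗ[F] V :=
  LinearMap.coprod ((LinearMap.applyₗ v).comp (aeval A).toLinearMap)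
    ((LinearMap.applyₗ w).comp (aeval A).toLinearMap)

lemma cyc_apply (A : Module.End F V) (v w : V) (x : F[X] × F[X]) :
    cyc A v w x = aeval A x.1 v + aeval A x.2 w := by
  simp [cyc]

lemma adj_poly (B : LinearMap.BilinForm F V) (A A' : Module.End F V)
    (h : ∀ x y, B (A x) y = B x (A' y)) (f : F[X]) (x y : V) :
    B (aeval A f x) y = B x (aeval A' f y) := by
  induction f using Polynomial.induction_on' generalizing x y with
  | add p q hp hq => simp [hp, hq]
  | monomial n a =>
    have : ∀ n : ℕ, ∀ x y, B ((A ^ n) x) y = B x ((A' ^ n) y) := by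
      intro n
      induction n with
      | zero => simp
      | succ n ih => intro x y; rw [pow_succ, pow_succ']; simp [ih, h]
    simp [aeval_monomial, this]

lemma exists_poly_inv [FiniteDimensional F V] (A A' : Module.End F V) (h : A * A' = 1)
    (h' : A' * A = 1) : ∃ r : F[X], A' = aeval A r := by
  have hu : IsUnit A := ⟨⟨A, A', h, h'⟩, rfl⟩
  have h0 : (minpoly F A).coeff 0 ≠ 0 := by
    intro hc
    have hX : X ∣ minpoly F A := X_dvd_iff.2 hc
    obtain ⟨g, hg⟩ := hX
    have hm : minpoly F A ≠ 0 := minpoly.ne_zero (Algebra.IsIntegral.isIntegral A)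
    have hg0 : g ≠ 0 := by rintro rfl; simp at hg; exact hm hg
    have h1 : aeval A g = 0 := by
      have := minpoly.aeval F A
      rw [hg, map_mul, aeval_X] at this
      calc aeval A g = A' * (A * aeval A g) := by rw [← mul_assoc, h', one_mul]
        _ = 0 := by rw [this, mul_zero]
    have h2 := natDegree_le_of_dvd (minpoly.dvd F A h1) hg0
    rw [hg, natDegree_X_mul hg0] at h2
    omega
  set m := minpoly F A with hm
  refine ⟨C (-(m.coeff 0)⁻¹) * divX m, ?_⟩
  have h1 : A * aeval A (divX m) = - algebraMap F _ (m.coeff 0) := by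
    have := congrArg (aeval A) (X_mul_divX_add m)
    rw [hm, minpoly.aeval, ← hm, map_add, map_mul, aeval_X, aeval_C] at this
    exact eq_neg_of_add_eq_zero_left this
  calc A' = A' * (A * aeval A (C (-(m.coeff 0)⁻¹) * divX m)) := by
        rw [map_mul, aeval_C, Algebra.left_comm, h1, mul_neg, ← map_mul]
        simp [h0]
    _ = _ := by rw [← mul_assoc, h', one_mul]

lemma build (B : LinearMap.BilinForm F V) (hsk : ∀ x y, B x y = - B y x)
    (A A' : Module.End F V) (h : ∀ x y, B (A x) y = B x (A' y))
    (h' : ∀ x y, B (A' x) y = B x (A y)) (hc : ∀ f g : F[X], Commute (aeval A f) (aeval A' g))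
    (v w v' w' : V)
    (hvv : ∀ f g : F[X], B (aeval A f (aeval A' g v')) v' = B (aeval A f (aeval A' g v)) v)
    (hww : ∀ f g : F[X], B (aeval A f (aeval A' g w')) w' = B (aeval A f (aeval A' g w)) w)
    (hvw : ∀ f g : F[X], B (aeval A f (aeval A' g v')) w' = B (aeval A f (aeval A' g w)) v)
    (hr : LinearMap.range (cyc A' v' w') = LinearMap.range (cyc A v w)) :
    ∃ P : Submodule F (V × V), (∀ x ∈ P, ∀ y ∈ P, B x.2 y.2 = - B x.1 y.1) ∧
      (∀ x ∈ P, (A x.1, A' x.2) ∈ P) ∧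
      P.map (LinearMap.fst F V V) = LinearMap.range (cyc A v w) ∧
      P.map (LinearMap.snd F V V) = LinearMap.range (cyc A v w) := by
  have hadj := adj_poly B A A' h
  have hadj' := adj_poly B A' A h'
  have hcm : ∀ (f g : F[X]) x, aeval A f (aeval A' g x) = aeval A' g (aeval A f x) := fun f g x =>
    LinearMap.congr_fun (hc f g).eq x
  -- reformulated
  have key : ∀ a b a' b' : V, (∀ f g : F[X], B (aeval A f (aeval A' g a')) b' = B (aeval A f (aeval A' g b)) a) →
      ∀ f g : F[X], B (aeval A' f a') (aeval A' g b') = - B (aeval A f a) (aeval A g b) := by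
    intro a b a' b' H f g
    rw [← hadj, H, hcm, hadj', hsk]
  have hwv : ∀ f g : F[X], B (aeval A f (aeval A' g w')) v' = B (aeval A f (aeval A' g v)) w := by
    intro f g
    have H : ∀ a b, B (aeval A f (aeval A' g a)) b = - B (aeval A g (aeval A' f b)) a := by
      intro a b
      rw [hadj, hadj', hsk]
    rw [H, hvw, ← H]
  refine ⟨LinearMap.range ((cyc A v w).prod (cyc A' v' w')), ?_, ?_, ?_, ?_⟩
  · rintro _ ⟨⟨f, g⟩, rfl⟩ _ ⟨⟨f2, g2⟩, rfl⟩
    change B (cyc A' v' w' (f, g)) (cyc A' v' w' (f2, g2)) =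
      - B (cyc A v w (f, g)) (cyc A v w (f2, g2))
    simp only [cyc_apply, map_add, LinearMap.add_apply]
    rw [key v v v' v' hvv, key v w v' w' hvw, key w w w' w' hww, key w v w' v' hwv]
    ring
  · rintro _ ⟨⟨f, g⟩, rfl⟩
    refine ⟨(X * f, X * g), ?_⟩
    simp [cyc_apply]
  · rw [← LinearMap.range_comp]; congr 1
  · rw [← LinearMap.range_comp, ← hr]; congr 1

lemma soc (A : Module.End F V) {p : F[X]} (hp : Irreducible p) {k : ℕ} (hk : 0 < k) (v : V)
    (hv : aeval A (p ^ k) v = 0) (f : F[X]) (hf : aeval A f v ≠ 0) :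
    ∃ a : F[X], aeval A a (aeval A f v) = aeval A (p ^ (k - 1)) v := by
  rcases poly_dich hp hk f with ⟨c, rfl⟩ | ⟨a, b, hab⟩
  · exfalso; apply hf
    rw [mul_comm, map_mul, Module.End.mul_apply, hv, map_zero]
  · refine ⟨a, ?_⟩
    rw [← hab, map_add, map_mul, map_mul, LinearMap.add_apply, Module.End.mul_apply,
      Module.End.mul_apply, hv, map_zero, add_zero]

lemma ann_dvd (A : Module.End F V) {p : F[X]} (hp : Irreducible p) {k : ℕ} (hk : 0 < k) (v : V)
    (hv : aeval A (p ^ k) v = 0) (hv1 : aeval A (p ^ (k - 1)) v ≠ 0) (f : F[X])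
    (hf : aeval A f v = 0) : p ^ k ∣ f := by
  rcases poly_dich hp hk f with h | ⟨a, b, hab⟩
  · exact h
  · exfalso; apply hv1
    rw [← hab, map_add, map_mul, map_mul, LinearMap.add_apply, Module.End.mul_apply,
      Module.End.mul_apply, hv, hf, map_zero, map_zero, add_zero]

lemma range_cyc_le (A A' : Module.End F V) (r : F[X]) (hr : A' = aeval A r) (v w v' w' : V)
    (hv : v' ∈ LinearMap.range (cyc A v w)) (hw : w' ∈ LinearMap.range (cyc A v w)) :
    LinearMap.range (cyc A' v' w') ≤ LinearMap.range (cyc A v w) := by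
  rintro _ ⟨⟨f, g⟩, rfl⟩
  have hst : ∀ f : F[X], ∀ x ∈ LinearMap.range (cyc A v w),
      aeval A' f x ∈ LinearMap.range (cyc A v w) := by
    rintro f _ ⟨⟨a, b⟩, rfl⟩
    refine ⟨(f.comp r * a, f.comp r * b), ?_⟩
    simp [cyc_apply, hr, aeval_comp]
  rw [cyc_apply]
  exact Submodule.add_mem _ (hst _ _ hv) (hst _ _ hw)

lemma left_mem_cyc (A : Module.End F V) (v w : V) : v ∈ LinearMap.range (cyc A v w) :=
  ⟨(1, 0), by simp [cyc_apply]⟩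

lemma right_mem_cyc (A : Module.End F V) (v w : V) : w ∈ LinearMap.range (cyc A v w) :=
  ⟨(0, 1), by simp [cyc_apply]⟩

lemma step [FiniteDimensional F V] [Nontrivial V] (B : LinearMap.BilinForm F V)
    (hsk : ∀ x y, B x y = - B y x) (hnd : ∀ x, (∀ y, B x y = 0) → x = 0)
    (A A' : Module.End F V) (hAA' : A * A' = 1) (hA'A : A' * A = 1)
    (h : ∀ x y, B (A x) y = B x (A' y)) :
    ∃ (P : Submodule F (V × V)) (U : Submodule F V),
      (∀ x ∈ P, ∀ y ∈ P, B x.2 y.2 = - B x.1 y.1) ∧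
      (∀ x ∈ P, (A x.1, A' x.2) ∈ P) ∧
      P.map (LinearMap.fst F V V) = U ∧ P.map (LinearMap.snd F V V) = U ∧
      (∀ x ∈ U, (∀ y ∈ U, B x y = 0) → x = 0) ∧ U ≠ ⊥ := by
  have h' : ∀ x y, B (A' x) y = B x (A y) := by
    intro x y
    rw [hsk, ← h, hsk, neg_neg]
  have hadj := adj_poly B A A' h
  have hadj' := adj_poly B A' A h'
  obtain ⟨r, hr⟩ := exists_poly_inv A A' hAA' hA'A
  obtain ⟨r', hr'⟩ := exists_poly_inv A' A hA'A hAA'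
  have tr : ∀ f : F[X], ∃ g : F[X], aeval A' f = aeval A g := fun f =>
    ⟨f.comp r, by rw [aeval_comp, ← hr]⟩
  have tr' : ∀ f : F[X], ∃ g : F[X], aeval A f = aeval A' g := fun f =>
    ⟨f.comp r', by rw [aeval_comp, ← hr']⟩
  have hc : ∀ f g : F[X], Commute (aeval A f) (aeval A' g) := by
    intro f g
    obtain ⟨g', hg⟩ := tr g
    rw [hg]
    exact (Commute.all f g').map (aeval A)
  have hcm : ∀ (f g : F[X]) x, aeval A f (aeval A' g x) = aeval A' g (aeval A f x) := fun f g x =>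
    LinearMap.congr_fun (hc f g).eq x
  have cm : ∀ (f g : F[X]) x, aeval A f (aeval A g x) = aeval A g (aeval A f x) := fun f g x =>
    LinearMap.congr_fun ((Commute.all f g).map (aeval A)).eq x
  have cm' : ∀ (f g : F[X]) x, aeval A' f (aeval A' g x) = aeval A' g (aeval A' f x) :=
    fun f g x => LinearMap.congr_fun ((Commute.all f g).map (aeval A')).eq x
  have rng : ∀ v w, LinearMap.range (cyc A' v w) = LinearMap.range (cyc A v w) := fun v w =>
    le_antisymm (range_cyc_le A A' r hr _ _ _ _ (left_mem_cyc _ _ _) (right_mem_cyc _ _ _))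
      (range_cyc_le A' A r' hr' _ _ _ _ (left_mem_cyc _ _ _) (right_mem_cyc _ _ _))
  -- the polynomial data
  have hm0 : minpoly F A ≠ 0 := minpoly.ne_zero (Algebra.IsIntegral.isIntegral A)
  obtain ⟨p, hp, hpm⟩ := WfDvdMonoid.exists_irreducible_factor (minpoly.not_isUnit F A) hm0
  obtain ⟨k, q0, hmk, hq0⟩ : ∃ (k : ℕ) (q0 : F[X]), minpoly F A = p ^ k * q0 ∧ ¬ p ∣ q0 :=
    ⟨_, FiniteMultiplicity.exists_eq_pow_mul_and_not_dvd
      (FiniteMultiplicity.of_prime_left hp.prime hm0)⟩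
  have hk : 0 < k := by
    rcases Nat.eq_zero_or_pos k with rfl | hk
    · rw [pow_zero, one_mul] at hmk
      rw [hmk] at hpm
      exact absurd hpm hq0
    · exact hk
  have hpk : p ^ k = p * p ^ (k - 1) := by
    rw [← pow_succ']; congr 1; omega
  have hne : aeval A (p ^ (k - 1) * q0) ≠ 0 := by
    intro h0
    have hd := minpoly.dvd F A h0
    have hn : p ^ (k - 1) * q0 ≠ 0 := by
      intro h1; apply hm0; rw [hmk, hpk, mul_assoc, h1, mul_zero]
    rw [hmk, hpk, mul_assoc] at hd
    obtain ⟨c, hcc⟩ := hd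
    apply hp.not_isUnit
    refine IsUnit.of_mul_eq_one c ?_
    apply mul_right_cancel₀ hn
    rw [one_mul]
    conv_rhs => rw [hcc]
    ring
  obtain ⟨v0, hv0⟩ : ∃ v0, aeval A (p ^ (k - 1) * q0) v0 ≠ 0 := by
    by_contra hcon
    push Not at hcon
    exact hne (LinearMap.ext hcon)
  obtain ⟨v, hv, hv1⟩ : ∃ v, aeval A (p ^ k) v = 0 ∧ aeval A (p ^ (k - 1)) v ≠ 0 := by
    refine ⟨aeval A q0 v0, ?_, ?_⟩
    · rw [← Module.End.mul_apply, ← map_mul, ← hmk, minpoly.aeval, LinearMap.zero_apply]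
    · rwa [← Module.End.mul_apply, ← map_mul]
  have hvne : v ≠ 0 := by rintro rfl; simp at hv1
  by_cases hI : ∀ g : F[X], B (aeval A (p ^ (k - 1)) v) (aeval A g v) = 0
  swap
  · obtain ⟨P, h1, h2, h3, h4⟩ := build B hsk A A' h h' hc v 0 v 0 (fun _ _ => rfl)
      (fun _ _ => rfl) (by simp) (rng _ _)
    refine ⟨P, _, h1, h2, h3, h4, ?_, ?_⟩
    · rintro _ ⟨⟨f, g⟩, rfl⟩ hx
      by_contra hx0
      simp only [cyc_apply, map_zero, add_zero] at hx hx0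
      apply hI
      intro g
      obtain ⟨a, ha⟩ := soc A hp hk v hv f hx0
      rw [← ha, hadj]
      apply hx
      rw [← hcm]
      obtain ⟨b, hb⟩ := tr a
      exact ⟨(g * b, 0), by simp [cyc_apply, hb]⟩
    · intro hU
      apply hvne
      have := left_mem_cyc A v 0
      rwa [hU, Submodule.mem_bot] at this
  -- second generator
  obtain ⟨w, hw, hvw⟩ : ∃ w, aeval A' (p ^ k) w = 0 ∧ B (aeval A (p ^ (k - 1)) v) w ≠ 0 := by
    obtain ⟨w1, hw1⟩ : ∃ w, B (aeval A (p ^ (k - 1)) v) w ≠ 0 := by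
      by_contra hcon
      push Not at hcon
      exact hv1 (hnd _ hcon)
    have hcop : IsCoprime (p ^ k) q0 := ((hp.coprime_iff_not_dvd).2 hq0).pow_left
    obtain ⟨a, b, hab⟩ := hcop
    have hz : ∀ x, aeval A' (p ^ k * q0) x = 0 := by
      intro x
      apply hnd
      intro y
      rw [hadj', ← hmk, minpoly.aeval, LinearMap.zero_apply, map_zero]
    refine ⟨aeval A' (b * q0) w1, ?_, ?_⟩
    · rw [← Module.End.mul_apply, ← map_mul, show p ^ k * (b * q0) = b * (p ^ k * q0) by ring,
        map_mul, Module.End.mul_apply, hz, map_zero]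
    · have e1 : w1 = aeval A' (p ^ k * a) w1 + aeval A' (b * q0) w1 := by
        rw [← LinearMap.add_apply, ← map_add, mul_comm, hab, map_one, Module.End.one_apply]
      have e2 : B (aeval A (p ^ (k - 1)) v) (aeval A' (p ^ k * a) w1) = 0 := by
        rw [map_mul, Module.End.mul_apply, ← hadj, cm, hv, map_zero, map_zero, LinearMap.zero_apply]
      rw [e1, map_add, e2, zero_add] at hw1
      exact hw1
  -- the pairing between the cyclic spaces is nondegenerate
  have nl : ∀ f : F[X], (∀ g : F[X], B (aeval A f v) (aeval A g w) = 0) → aeval A f v = 0 := by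
    intro f hf
    by_contra hx
    obtain ⟨a, ha⟩ := soc A hp hk v hv f hx
    apply hvw
    obtain ⟨b, hb⟩ := tr a
    rw [← ha, hadj, hb, hf]
  have hvw' : B v (aeval A' (p ^ (k - 1)) w) ≠ 0 := by rwa [← hadj]
  have nr : ∀ f : F[X], (∀ g : F[X], B (aeval A g v) (aeval A f w) = 0) → aeval A f w = 0 := by
    intro f hf
    by_contra hx
    obtain ⟨f', hf'⟩ := tr' f
    rw [hf'] at hx
    obtain ⟨a, ha⟩ := soc A' hp hk w hw f' hx
    apply hvw'
    rw [← ha, ← hadj, ← hf', hf]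
  have hUnd : ∀ x ∈ LinearMap.range (cyc A v w),
      (∀ y ∈ LinearMap.range (cyc A v w), B x y = 0) → x = 0 := by
    rintro _ ⟨⟨f, g⟩, rfl⟩ hx
    simp only [cyc_apply] at hx ⊢
    have hx1 : ∀ s : F[X], B (aeval A f v + aeval A g w) (aeval A s v) = 0 := fun s =>
      hx _ ⟨(s, 0), by simp [cyc_apply]⟩
    have hx2 : ∀ s : F[X], B (aeval A f v + aeval A g w) (aeval A s w) = 0 := fun s =>
      hx _ ⟨(0, s), by simp [cyc_apply]⟩
    have hfv : aeval A f v = 0 := by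
      by_contra hne0
      obtain ⟨a, ha⟩ := soc A hp hk v hv f hne0
      obtain ⟨b, hb⟩ := tr a
      have e1 : aeval A (a * g) w = 0 := by
        apply nr
        intro s
        have := hx1 (b * s)
        rw [map_mul, ← hb, Module.End.mul_apply, ← hadj, map_add, ha, map_add,
          LinearMap.add_apply, hI, zero_add, hsk, neg_eq_zero] at this
        rwa [map_mul, Module.End.mul_apply]
      apply hv1
      apply nl
      intro s
      have := hx2 (b * s)
      rw [map_mul, ← hb, Module.End.mul_apply, ← hadj, map_add, ha,
        ← Module.End.mul_apply (aeval A a), ← map_mul, e1, add_zero] at this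
      exact this
    have hgw : aeval A g w = 0 := by
      apply nr
      intro s
      have := hx1 s
      rw [hfv, zero_add, hsk, neg_eq_zero] at this
      exact this
    rw [hfv, hgw, add_zero]
  have hUbot : LinearMap.range (cyc A v w) ≠ ⊥ := by
    intro hU
    apply hvne
    have := left_mem_cyc A v w
    rwa [hU, Submodule.mem_bot] at this
  obtain ⟨q, hq⟩ := tr p
  by_cases hpq : p ∣ q
  · -- self-dual case
    obtain ⟨m, rfl⟩ := hpq
    have hw0 : ∀ j x, aeval A' (p ^ j) x = 0 → aeval A (p ^ j) x = 0 := by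
      intro j x hx
      apply hnd
      intro y
      have e : aeval A' (p ^ j) y = aeval A (p ^ j) (aeval A (m ^ j) y) := by
        rw [map_pow, hq, ← map_pow, mul_pow, map_mul, Module.End.mul_apply]
      rw [hadj, e, ← hadj', hx, map_zero, LinearMap.zero_apply]
    have hwk : aeval A (p ^ k) w = 0 := hw0 k w hw
    -- the isometry partner of w
    obtain ⟨u, hu⟩ : ∃ u : F[X], ∀ g : F[X],
        B (aeval A g v) (aeval A u w) = B v (aeval A g w) := by
      have hw1 : ∀ g : F[X], aeval A g v = 0 → aeval A g w = 0 := by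
        intro g hg
        obtain ⟨c, rfl⟩ := ann_dvd A hp hk v hv hv1 g hg
        rw [mul_comm, map_mul, Module.End.mul_apply, hwk, map_zero]
      let α : F[X] →ₗ[F] V := (LinearMap.applyₗ v).comp (aeval A).toLinearMap
      let γ : F[X] →ₗ[F] V := (LinearMap.applyₗ w).comp (aeval A).toLinearMap
      have hα : ∀ g, α g = aeval A g v := fun g => rfl
      have hγ : ∀ g, γ g = aeval A g w := fun g => rfl
      have hβ : (B v).comp γ ∈ LinearMap.range α.dualMap := by
        rw [LinearMap.range_dualMap_eq_dualAnnihilator_ker, Submodule.mem_dualAnnihilator]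
        intro g hg
        rw [LinearMap.mem_ker, hα] at hg
        rw [LinearMap.comp_apply, hγ, hw1 g hg, map_zero]
      obtain ⟨ψ, hψ⟩ := hβ
      let b : LinearMap.range α →ₗ[F] LinearMap.range γ →ₗ[F] F :=
        B.domRestrict₁₂ (LinearMap.range α) (LinearMap.range γ)
      have hb : b.IsPerfPair := by
        apply LinearMap.IsPerfPair.of_injective
        · rw [injective_iff_map_eq_zero]
          rintro ⟨_, f, rfl⟩ hf
          apply Subtype.ext
          apply nl
          intro g
          exact LinearMap.congr_fun hf ⟨_, g, rfl⟩
        · rw [injective_iff_map_eq_zero]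
          rintro ⟨_, f, rfl⟩ hf
          apply Subtype.ext
          apply nr
          intro g
          exact LinearMap.congr_fun hf ⟨_, g, rfl⟩
      obtain ⟨⟨_, u, rfl⟩, hu⟩ := (LinearMap.IsPerfPair.bijective_right b).2
        (ψ.comp (LinearMap.range α).subtype)
      refine ⟨u, fun g => ?_⟩
      have e1 := LinearMap.congr_fun hu ⟨_, g, rfl⟩
      have e2 := LinearMap.congr_fun hψ g
      exact e1.trans e2
    obtain ⟨u', hu'⟩ := tr u
    have huu : aeval A' u (aeval A u w) = w := by
      have e : aeval A (u' * u - 1) w = 0 := by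
        apply nr
        intro g
        obtain ⟨g', hg'⟩ := tr g
        rw [map_sub, map_mul, ← hu', map_one, LinearMap.sub_apply, Module.End.one_apply, map_sub,
          Module.End.mul_apply, ← hadj, ← Module.End.mul_apply, ← map_mul, hu, map_mul,
          Module.End.mul_apply, cm, ← hadj', hg', hu, ← hg', ← hadj, sub_self]
      rw [map_sub, map_mul, ← hu', map_one, LinearMap.sub_apply, Module.End.one_apply,
        Module.End.mul_apply, sub_eq_zero] at e
      exact e
    obtain ⟨P, h1, h2, h3, h4⟩ := build B hsk A A' h h' hc v w v (-(aeval A u w)) (fun _ _ => rfl)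
      (by
        intro f g
        simp only [map_neg, LinearMap.neg_apply, neg_neg]
        rw [← hadj', ← hcm, cm' , huu])
      (by
        intro f g
        obtain ⟨g', hg'⟩ := tr g
        rw [map_neg, hg', ← Module.End.mul_apply, ← map_mul, hu, ← hsk, map_mul,
          Module.End.mul_apply])
      (by
        rw [rng]
        apply le_antisymm
        · exact range_cyc_le A A X (by simp) _ _ _ _ (left_mem_cyc _ _ _)
            (Submodule.neg_mem _ ⟨(0, u), by simp [cyc_apply]⟩)
        · refine range_cyc_le A A X (by simp) _ _ _ _ (left_mem_cyc _ _ _) ⟨(0, -u'), ?_⟩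
          simp only [cyc_apply, map_zero, LinearMap.zero_apply, zero_add, map_neg,
            LinearMap.neg_apply, neg_neg]
          rw [← hu', huu])
    exact ⟨P, _, h1, h2, h3, h4, hUnd, hUbot⟩
  · -- non-self-dual case
    have hcop : IsCoprime (p ^ k) (q ^ k) := ((hp.coprime_iff_not_dvd).2 hpq).pow
    obtain ⟨a, b, hab⟩ := hcop
    have hqk : aeval A (q ^ k) = aeval A' (p ^ k) := by rw [map_pow, ← hq, map_pow]
    have hvv : ∀ x : F[X], B (aeval A x v) v = 0 := by
      intro x
      have e : v = aeval A' (p ^ k) (aeval A b v) := by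
        conv_lhs => rw [← Module.End.one_apply (R := F) v, ← map_one (aeval (R := F) A), ← hab]
        rw [map_add, map_mul, map_mul, LinearMap.add_apply, Module.End.mul_apply,
          Module.End.mul_apply, hv, map_zero, zero_add, hqk, hcm]
      conv_lhs => rw [e]
      rw [← hadj, cm, ← e, hv, map_zero, map_zero, LinearMap.zero_apply]
    have hww : ∀ x : F[X], B (aeval A x w) w = 0 := by
      intro x
      have e : w = aeval A (p ^ k) (aeval A a w) := by
        conv_lhs => rw [← Module.End.one_apply (R := F) w, ← map_one (aeval (R := F) A), ← hab]
        rw [map_add, map_mul, map_mul, LinearMap.add_apply, Module.End.mul_apply,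
          Module.End.mul_apply, hqk, hw, map_zero, add_zero, cm]
      conv_lhs => rw [e]
      rw [← hadj', ← hcm, ← e, hw, map_zero, map_zero, LinearMap.zero_apply]
    have T : ∀ (f g : F[X]), ∃ s : F[X], ∀ x, aeval A f (aeval A' g x) = aeval A s x := by
      intro f g
      obtain ⟨g', hg'⟩ := tr g
      exact ⟨f * g', fun x => by rw [hg', map_mul, Module.End.mul_apply]⟩
    obtain ⟨P, h1, h2, h3, h4⟩ := build B hsk A A' h h' hc v w w v
      (by intro f g; obtain ⟨s, hs⟩ := T f g; rw [hs, hs, hvv, hww])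
      (by intro f g; obtain ⟨s, hs⟩ := T f g; rw [hs, hs, hvv, hww])
      (fun _ _ => rfl)
      (by
        rw [rng]
        apply le_antisymm
        · exact range_cyc_le A A X (by simp) _ _ _ _ (right_mem_cyc _ _ _) (left_mem_cyc _ _ _)
        · exact range_cyc_le A A X (by simp) _ _ _ _ (right_mem_cyc _ _ _) (left_mem_cyc _ _ _))
    exact ⟨P, _, h1, h2, h3, h4, hUnd, hUbot⟩

lemma graph_exists : ∀ (n : ℕ) (V : Type*) [AddCommGroup V] [Module F V] [FiniteDimensional F V]
    (B : LinearMap.BilinForm F V)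
    (_ : ∀ x y, B x y = - B y x) (_ : ∀ x, (∀ y, B x y = 0) → x = 0)
    (A A' : Module.End F V) (_ : A * A' = 1) (_ : A' * A = 1)
    (_ : ∀ x y, B (A x) y = B x (A' y)) (_ : Module.finrank F V = n),
    ∃ (P : Submodule F (V × V)),
      (∀ x ∈ P, ∀ y ∈ P, B x.2 y.2 = - B x.1 y.1) ∧
      (∀ x ∈ P, (A x.1, A' x.2) ∈ P) ∧
      P.map (LinearMap.fst F V V) = ⊤ ∧ P.map (LinearMap.snd F V V) = ⊤ := by
  intro n
  induction n using Nat.strong_induction_on with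
  | _ n ih =>
  intro V _ _ _ B hsk hnd A A' hAA' hA'A h hn
  rcases subsingleton_or_nontrivial V with hV | hV
  · exact ⟨⊥, by simp, by simp, Subsingleton.elim _ _, Subsingleton.elim _ _⟩
  obtain ⟨P, U, p1, p2, p3, p4, hU, hUbot⟩ := step B hsk hnd A A' hAA' hA'A h
  have h' : ∀ x y, B (A' x) y = B x (A y) := by
    intro x y
    rw [hsk, ← h, hsk, neg_neg]
  have hUA : ∀ x ∈ U, A x ∈ U := by
    intro x hx
    rw [← p3] at hx
    obtain ⟨z, hz, rfl⟩ := hx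
    rw [← p3]
    exact ⟨_, p2 z hz, rfl⟩
  have hUA' : ∀ x ∈ U, A' x ∈ U := by
    intro x hx
    rw [← p4] at hx
    obtain ⟨z, hz, rfl⟩ := hx
    rw [← p4]
    exact ⟨_, p2 z hz, rfl⟩
  have hrefl : B.IsRefl := by
    intro x y hxy
    rw [hsk, hxy, neg_zero]
  let W := B.orthogonal U
  have hWm : ∀ x, x ∈ W ↔ ∀ u ∈ U, B u x = 0 := fun x => Iff.rfl
  have hdis : Disjoint U W := by
    rw [Submodule.disjoint_def]
    intro x hx hxW
    apply hU x hx
    intro y hy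
    rw [hsk, (hWm x).1 hxW y hy, neg_zero]
  have hcompl : IsCompl U W := (LinearMap.BilinForm.isCompl_orthogonal_iff_disjoint hrefl).2 hdis
  have hWA : ∀ x ∈ W, A x ∈ W := by
    intro x hx
    rw [hWm] at hx ⊢
    intro u hu
    rw [← h']
    exact hx _ (hUA' u hu)
  have hWA' : ∀ x ∈ W, A' x ∈ W := by
    intro x hx
    rw [hWm] at hx ⊢
    intro u hu
    rw [← h]
    exact hx _ (hUA u hu)
  have hfr : Module.finrank F W < n := by
    have e1 := Submodule.finrank_add_eq_of_isCompl hcompl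
    have e2 : 0 < Module.finrank F U := by
      rw [Nat.pos_iff_ne_zero]
      intro h0
      exact hUbot (Submodule.finrank_eq_zero.1 h0)
    omega
  obtain ⟨Q, q1, q2, q3, q4⟩ := ih _ hfr W (B.domRestrict₁₂ W W)
    (fun x y => hsk x y)
    (by
      intro x hx
      apply Subtype.ext
      apply hnd
      intro y
      have hy : y ∈ U ⊔ W := by rw [hcompl.sup_eq_top]; trivial
      obtain ⟨a, ha, b, hb, rfl⟩ := Submodule.mem_sup.1 hy
      rw [map_add, hsk, (hWm _).1 x.2 a ha, neg_zero, zero_add]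
      exact hx ⟨b, hb⟩)
    (A.restrict hWA) (A'.restrict hWA')
    (by
      ext x
      exact LinearMap.congr_fun hAA' (x : V))
    (by
      ext x
      exact LinearMap.congr_fun hA'A (x : V))
    (fun x y => h x y) rfl
  have z1 : ∀ a ∈ U, ∀ b ∈ W, B a b = 0 := fun a ha b hb => (hWm b).1 hb a ha
  have z2 : ∀ a ∈ U, ∀ b ∈ W, B b a = 0 := fun a ha b hb => by rw [hsk, z1 a ha b hb, neg_zero]
  have P1 : ∀ x ∈ P, x.1 ∈ U := fun x hx => by rw [← p3]; exact ⟨x, hx, rfl⟩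
  have P2 : ∀ x ∈ P, x.2 ∈ U := fun x hx => by rw [← p4]; exact ⟨x, hx, rfl⟩
  refine ⟨P ⊔ Q.map (W.subtype.prodMap W.subtype), ?_, ?_, ?_, ?_⟩
  · intro x hx y hy
    obtain ⟨a, ha, _, ⟨b, hb, rfl⟩, rfl⟩ := Submodule.mem_sup.1 hx
    obtain ⟨c, hc, _, ⟨d, hd, rfl⟩, rfl⟩ := Submodule.mem_sup.1 hy
    have e1 : B b.2 d.2 = - B b.1 d.1 := q1 b hb d hd
    have e2 := p1 a ha c hc
    simp only [LinearMap.prodMap_apply, Prod.fst_add, Prod.snd_add, map_add, LinearMap.add_apply,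
      Submodule.subtype_apply]
    rw [e1, e2, z1 _ (P2 a ha) _ d.2.2, z1 _ (P1 a ha) _ d.1.2, z2 _ (P2 c hc) _ b.2.2,
      z2 _ (P1 c hc) _ b.1.2]
    ring
  · intro x hx
    obtain ⟨a, ha, _, ⟨b, hb, rfl⟩, rfl⟩ := Submodule.mem_sup.1 hx
    refine Submodule.mem_sup.2 ⟨_, p2 a ha, _, ⟨_, q2 b hb, rfl⟩, ?_⟩
    simp
  · rw [Submodule.map_sup, p3, ← hcompl.sup_eq_top]
    congr 1
    rw [← Submodule.map_comp]
    have : LinearMap.fst F V V ∘ₗ W.subtype.prodMap W.subtype = W.subtype ∘ₗ LinearMap.fst F W W := by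
      ext <;> simp
    rw [this, Submodule.map_comp, q3, Submodule.map_top, Submodule.range_subtype]
  · rw [Submodule.map_sup, p4, ← hcompl.sup_eq_top]
    congr 1
    rw [← Submodule.map_comp]
    have : LinearMap.snd F V V ∘ₗ W.subtype.prodMap W.subtype = W.subtype ∘ₗ LinearMap.snd F W W := by
      ext <;> simp
    rw [this, Submodule.map_comp, q4, Submodule.map_top, Submodule.range_subtype]

lemma anti_exists [FiniteDimensional F V] (B : LinearMap.BilinForm F V)
    (hsk : ∀ x y, B x y = - B y x) (hnd : ∀ x, (∀ y, B x y = 0) → x = 0)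
    (A A' : Module.End F V) (hAA' : A * A' = 1) (hA'A : A' * A = 1)
    (h : ∀ x y, B (A x) y = B x (A' y)) :
    ∃ D : Module.End F V, (∀ x y, B (D x) (D y) = - B x y) ∧ D * A = A' * D := by
  obtain ⟨P, p1, p2, p3, p4⟩ := graph_exists (F := F) _ V B hsk hnd A A' hAA' hA'A h rfl
  have huniq : ∀ x ∈ P, x.1 = 0 → x.2 = 0 := by
    intro x hx hx0
    apply hnd
    intro y
    have hy : y ∈ P.map (LinearMap.snd F V V) := by rw [p4]; trivial
    obtain ⟨z, hz, rfl⟩ := hy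
    have := p1 x hx z hz
    rw [hx0, map_zero, LinearMap.zero_apply, neg_zero] at this
    exact this
  have hex : ∀ x, ∃ y, (x, y) ∈ P := by
    intro x
    have hx : x ∈ P.map (LinearMap.fst F V V) := by rw [p3]; trivial
    obtain ⟨z, hz, rfl⟩ := hx
    exact ⟨z.2, hz⟩
  have hun : ∀ x y z, (x, y) ∈ P → (x, z) ∈ P → y = z := by
    intro x y z hy hz
    have := huniq _ (P.sub_mem hy hz) (by simp)
    exact sub_eq_zero.1 this
  choose D hD using hex
  refine ⟨{ toFun := D, map_add' := ?_, map_smul' := ?_ }, ?_, ?_⟩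
  · intro x y
    exact hun _ _ _ (hD _) (P.add_mem (hD x) (hD y))
  · intro c x
    exact hun _ _ _ (hD _) (P.smul_mem c (hD x))
  · intro x y
    exact p1 _ (hD x) _ (hD y)
  · ext x
    exact hun _ _ _ (hD _) (p2 _ (hD x))

end

theorem stmt10 {n : ℕ} (hn : 2 ≤ n) (F : Type*) [Field F] [Fintype F]
    (A : Matrix (Fin n ⊕ Fin n) (Fin n ⊕ Fin n) F)
    (hA : A * Matrix.J (Fin n) F * Matrix.transpose A = Matrix.J (Fin n) F) :
    ∃ (C : Matrix (Fin n ⊕ Fin n) (Fin n ⊕ Fin n) F) (μ : F),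
      IsUnit C.det ∧ μ ≠ 0 ∧
      C * Matrix.J (Fin n) F * Matrix.transpose C = μ • Matrix.J (Fin n) F ∧
      C * A * C⁻¹ = A⁻¹ := by
  have hJu : IsUnit (Matrix.J (Fin n) F).det := Matrix.isUnit_det_J (Fin n) F
  have hdet : ∀ (C : Matrix (Fin n ⊕ Fin n) (Fin n ⊕ Fin n) F),
      IsUnit (C * Matrix.J (Fin n) F * Cᵀ).det → IsUnit C.det := by
    intro C hC
    rw [Matrix.det_mul, Matrix.det_mul] at hC
    exact isUnit_of_mul_isUnit_left (isUnit_of_mul_isUnit_left hC)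
  have hAu : IsUnit A.det := hdet A (by rw [hA]; exact hJu)
  let B : LinearMap.BilinForm F (Fin n ⊕ Fin n → F) := Matrix.toBilin' (Matrix.J (Fin n) F)
  have hB : ∀ x y, B x y = x ⬝ᵥ (Matrix.J (Fin n) F) *ᵥ y := fun x y =>
    Matrix.toBilin'_apply' _ _ _
  have hBm : ∀ (M N : Matrix (Fin n ⊕ Fin n) (Fin n ⊕ Fin n) F) x y,
      B (M *ᵥ x) (N *ᵥ y) = x ⬝ᵥ (Mᵀ * Matrix.J (Fin n) F * N) *ᵥ y := by
    intro M N x y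
    rw [hB, Matrix.mulVec_mulVec, Matrix.dotProduct_mulVec, Matrix.vecMul_mulVec,
      ← Matrix.dotProduct_mulVec, Matrix.mul_assoc]
  have hsk : ∀ x y, B x y = - B y x := by
    intro x y
    rw [hB, hB, Matrix.dotProduct_mulVec, ← Matrix.mulVec_transpose, Matrix.J_transpose,
      Matrix.neg_mulVec, neg_dotProduct, dotProduct_comm]
  have hnd : ∀ x, (∀ y, B x y = 0) → x = 0 := by
    intro x hx
    have h1 : x ᵥ* Matrix.J (Fin n) F = 0 := by
      apply dotProduct_eq_zero
      intro y
      rw [← Matrix.dotProduct_mulVec, ← hB, hx]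
    have h2 : x ᵥ* (Matrix.J (Fin n) F * (Matrix.J (Fin n) F)⁻¹) = 0 := by
      rw [← Matrix.vecMul_vecMul, h1, Matrix.zero_vecMul]
    rwa [Matrix.mul_nonsing_inv _ hJu, Matrix.vecMul_one] at h2
  have hAtu : IsUnit (Aᵀ).det := by rwa [Matrix.det_transpose]
  obtain ⟨D, hD1, hD2⟩ := anti_exists B hsk hnd (Matrix.toLin' Aᵀ) (Matrix.toLin' (Aᵀ)⁻¹)
    (by rw [Module.End.mul_eq_comp, ← Matrix.toLin'_mul, Matrix.mul_nonsing_inv _ hAtu,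
          Matrix.toLin'_one]; rfl)
    (by rw [Module.End.mul_eq_comp, ← Matrix.toLin'_mul, Matrix.nonsing_inv_mul _ hAtu,
          Matrix.toLin'_one]; rfl)
    (by
      intro x y
      rw [Matrix.toLin'_apply, Matrix.toLin'_apply]
      have e := hBm Aᵀ Aᵀ x ((Aᵀ)⁻¹ *ᵥ y)
      rw [Matrix.transpose_transpose, hA, Matrix.mulVec_mulVec, Matrix.mul_nonsing_inv _ hAtu,
        Matrix.one_mulVec, ← hB] at e
      exact e)
  obtain ⟨E, rfl⟩ : ∃ E, D = Matrix.toLin' E := ⟨LinearMap.toMatrix' D, by simp⟩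
  have hE1 : Eᵀ * Matrix.J (Fin n) F * E = - Matrix.J (Fin n) F := by
    apply Matrix.toBilin'.injective
    refine LinearMap.ext fun x => LinearMap.ext fun y => ?_
    have := hD1 x y
    rw [Matrix.toLin'_apply, Matrix.toLin'_apply, hBm] at this
    rw [Matrix.toBilin'_apply', this, map_neg]
    rfl
  have hE2 : E * Aᵀ = (Aᵀ)⁻¹ * E := by
    rw [Module.End.mul_eq_comp, Module.End.mul_eq_comp, ← Matrix.toLin'_mul,
      ← Matrix.toLin'_mul] at hD2
    exact Matrix.toLin'.injective hD2
  have hC : IsUnit (Eᵀ).det := by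
    apply hdet
    rw [Matrix.transpose_transpose, hE1, Matrix.det_neg]
    exact (IsUnit.pow _ isUnit_one.neg).mul hJu
  refine ⟨Eᵀ, -1, hC, neg_ne_zero.2 one_ne_zero, ?_, ?_⟩
  · rw [Matrix.transpose_transpose, hE1, neg_smul, one_smul]
  · have e : A * Eᵀ = Eᵀ * A⁻¹ := by
      have := congrArg Matrix.transpose hE2
      rwa [Matrix.transpose_mul, Matrix.transpose_mul, Matrix.transpose_transpose,
        Matrix.transpose_nonsing_inv, Matrix.transpose_transpose] at this
    have e2 : Eᵀ * A = A⁻¹ * Eᵀ := by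
      calc Eᵀ * A = A⁻¹ * (A * Eᵀ) * A := by
            rw [← Matrix.mul_assoc, Matrix.nonsing_inv_mul _ hAu, Matrix.one_mul]
        _ = A⁻¹ * Eᵀ := by
            rw [e, Matrix.mul_assoc, Matrix.mul_assoc, Matrix.nonsing_inv_mul _ hAu, Matrix.mul_one]
    rw [e2, Matrix.mul_assoc, Matrix.mul_nonsing_inv _ hC, Matrix.mul_one]
end
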